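/- arXiv:2201.02781 — 11 statements merged into one kernel-verified Lean document; each statement's English description precedes it below -/
import Mathlib

section
/- For every integer n ≥ 4, the path P_n on n vertices satisfies fgndi_Σ(P_n) = 2; that is, P_n admits an NFSD total 2-coloring but no NFSD total 1-coloring. -/
open SimpleGraph Finset

-- The weight of a vertex `x`: its own color, plus the colors of its incident
-- edges, plus the colors of its neighbors.
open scoped Classical in
noncomputable def nfsdWeight {V : Type*} [Fintype V] (G : SimpleGraph V)
    (fV : V → ℕ) (fE : Sym2 V → ℕ) (x : V) : ℕ :=
  fV x + ∑ y ∈ univ.filter (fun y => G.Adj x y), (fE s(x, y) + fV y)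

/-- `fV, fE` is a neighbor full sum distinguishing total `k`-coloring of `G`:
all colors lie in `{1, …, k}` and adjacent vertices get distinct weights. -/
def IsNFSD {V : Type*} [Fintype V] (G : SimpleGraph V) (k : ℕ)
    (fV : V → ℕ) (fE : Sym2 V → ℕ) : Prop :=
  (∀ v, fV v ∈ Finset.Icc 1 k) ∧
  (∀ e ∈ G.edgeSet, fE e ∈ Finset.Icc 1 k) ∧
  (∀ x y, G.Adj x y → nfsdWeight G fV fE x ≠ nfsdWeight G fV fE y)

/-- `G` admits a neighbor full sum distinguishing total `k`-coloring. -/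
def HasNFSD {V : Type*} [Fintype V] (G : SimpleGraph V) (k : ℕ) : Prop :=
  ∃ fV fE, IsNFSD G k fV fE

/-- The neighbor full sum distinguishing total chromatic number `fgndi_Σ(G)`. -/
noncomputable def fgndi {V : Type*} [Fintype V] (G : SimpleGraph V) : ℕ :=
  sInf {k | HasNFSD G k}

theorem nfsdWeight_pathGraph_interior {n i : ℕ} (hi : i + 2 < n) (fV : Fin n → ℕ)
    (fE : Sym2 (Fin n) → ℕ) :
    nfsdWeight (pathGraph n) fV fE ⟨i + 1, by omega⟩ =
      fV ⟨i + 1, by omega⟩ +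
        ((fE s(⟨i + 1, by omega⟩, ⟨i, by omega⟩) + fV ⟨i, by omega⟩) +
          (fE s(⟨i + 1, by omega⟩, ⟨i + 2, hi⟩) + fV ⟨i + 2, hi⟩)) := by
  classical
  unfold nfsdWeight
  rw [← Finset.sum_pair (f := fun y => fE s(⟨i + 1, by omega⟩, y) + fV y)
    (a := ⟨i, by omega⟩) (b := ⟨i + 2, hi⟩) (by simp)]
  congr 2
  ext y
  simp only [mem_filter, mem_univ, true_and, pathGraph_adj, mem_insert, mem_singleton, Fin.ext_iff]
  omega

theorem nfsdWeight_pathGraph_first {n : ℕ} (hn : 1 < n) (fV : Fin n → ℕ)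
    (fE : Sym2 (Fin n) → ℕ) :
    nfsdWeight (pathGraph n) fV fE ⟨0, by omega⟩ =
      fV ⟨0, by omega⟩ + (fE s(⟨0, by omega⟩, ⟨1, hn⟩) + fV ⟨1, hn⟩) := by
  classical
  unfold nfsdWeight
  rw [← Finset.sum_singleton (fun y => fE s(⟨0, by omega⟩, y) + fV y) ⟨1, hn⟩]
  congr 2
  ext y
  simp only [mem_filter, mem_univ, true_and, pathGraph_adj, mem_singleton, Fin.ext_iff]
  omega

theorem nfsdWeight_pathGraph_last {n i : ℕ} (hi : i + 2 = n) (fV : Fin n → ℕ)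
    (fE : Sym2 (Fin n) → ℕ) :
    nfsdWeight (pathGraph n) fV fE ⟨i + 1, by omega⟩ =
      fV ⟨i + 1, by omega⟩ +
        (fE s(⟨i + 1, by omega⟩, ⟨i, by omega⟩) + fV ⟨i, by omega⟩) := by
  classical
  unfold nfsdWeight
  rw [← Finset.sum_singleton (fun y => fE s(⟨i + 1, by omega⟩, y) + fV y) ⟨i, by omega⟩]
  congr 2
  ext y
  simp only [mem_filter, mem_univ, true_and, pathGraph_adj, mem_singleton, Fin.ext_iff]
  omega

/-- The edge coloring `1, 1, 2, 2, 1, 1, 2, 2, …` of the path. -/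
def pathEdgeColoring (n : ℕ) (e : Sym2 (Fin n)) : ℕ :=
  1 + (e.inf.val / 2) % 2

theorem pathEdgeColoring_succ_right {n i : ℕ} (hi : i + 1 < n) :
    pathEdgeColoring n s(⟨i, by omega⟩, ⟨i + 1, hi⟩) = 1 + (i / 2) % 2 := by
  simp [pathEdgeColoring]

theorem pathEdgeColoring_succ_left {n i : ℕ} (hi : i + 1 < n) :
    pathEdgeColoring n s(⟨i + 1, hi⟩, ⟨i, by omega⟩) = 1 + (i / 2) % 2 := by
  rw [Sym2.eq_swap, pathEdgeColoring_succ_right]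

theorem nfsdWeight_pathEdgeColoring_ne_succ {n i : ℕ} (hn : 4 ≤ n) (hi : i + 1 < n) :
    nfsdWeight (pathGraph n) (fun _ => 1) (pathEdgeColoring n) ⟨i, by omega⟩ ≠
      nfsdWeight (pathGraph n) (fun _ => 1) (pathEdgeColoring n) ⟨i + 1, hi⟩ := by
  rcases i with _ | i
  · rw [nfsdWeight_pathGraph_first (by omega), nfsdWeight_pathGraph_interior (by omega),
      pathEdgeColoring_succ_left (by omega), pathEdgeColoring_succ_right (i := 0) (by omega)]
    omega
  · rw [nfsdWeight_pathGraph_interior hi, pathEdgeColoring_succ_left (by omega),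
      pathEdgeColoring_succ_right (i := i + 1) hi]
    rcases Nat.lt_or_ge (i + 3) n with h | h
    · rw [nfsdWeight_pathGraph_interior (i := i + 1) h, pathEdgeColoring_succ_left hi,
        pathEdgeColoring_succ_right (i := i + 2) h]
      omega
    · rw [nfsdWeight_pathGraph_last (i := i + 1) (by omega), pathEdgeColoring_succ_left hi]
      omega

theorem hasNFSD_pathGraph_two {n : ℕ} (hn : 4 ≤ n) : HasNFSD (pathGraph n) 2 := by
  refine ⟨fun _ => 1, pathEdgeColoring n, by simp, fun e _ => ?_, fun x y hxy => ?_⟩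
  · rw [Finset.mem_Icc, pathEdgeColoring]
    omega
  · obtain ⟨x, hx⟩ := x
    obtain ⟨y, hy⟩ := y
    rcases pathGraph_adj.1 hxy with h | h
    · obtain rfl : x + 1 = y := h
      exact nfsdWeight_pathEdgeColoring_ne_succ hn hy
    · obtain rfl : y + 1 = x := h
      exact (nfsdWeight_pathEdgeColoring_ne_succ hn hx).symm

theorem not_hasNFSD_pathGraph_one {n : ℕ} (hn : 4 ≤ n) : ¬ HasNFSD (pathGraph n) 1 := by
  rintro ⟨fV, fE, hV, hE, hne⟩
  have hV1 (v) : fV v = 1 := by simpa using hV v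
  have hE1 {x y} (h : (pathGraph n).Adj x y) : fE s(x, y) = 1 := by simpa using hE s(x, y) h
  apply hne ⟨1, by omega⟩ ⟨2, by omega⟩ (pathGraph_adj.2 (by simp))
  rw [nfsdWeight_pathGraph_interior (i := 0) (by omega),
    nfsdWeight_pathGraph_interior (i := 1) (by omega)]
  simp only [hV1]
  repeat rw [hE1 (pathGraph_adj.2 (by simp))]

theorem not_hasNFSD_zero {V : Type*} [Fintype V] [Nonempty V] (G : SimpleGraph V) :
    ¬ HasNFSD G 0 := by
  rintro ⟨fV, fE, hV, -⟩
  simpa using hV (Classical.arbitrary V)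

theorem stmt_3 (n : ℕ) (hn : 4 ≤ n) :
    fgndi (SimpleGraph.pathGraph n) = 2 ∧
      HasNFSD (SimpleGraph.pathGraph n) 2 ∧ ¬ HasNFSD (SimpleGraph.pathGraph n) 1 := by
  have h2 := hasNFSD_pathGraph_two hn
  have h1 := not_hasNFSD_pathGraph_one hn
  refine ⟨le_antisymm (Nat.sInf_le h2) (le_csInf ⟨2, h2⟩ fun k hk => ?_), h2, h1⟩
  have : Nonempty (Fin n) := ⟨⟨0, by omega⟩⟩
  by_contra! hk2
  interval_cases k
  · exact not_hasNFSD_zero _ hk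
  · exact h1 hk
end

section
/- The cycle C_3 on three vertices satisfies fgndi_Σ(C_3) = 3; that is, C_3 admits an NFSD total 3-coloring but no NFSD total 2-coloring. -/
open SimpleGraph Finset

/-- In a complete graph every weight is the sum of all vertex colors plus the colors of the
incident edges. -/
theorem nfsdWeight_top {V : Type*} [Fintype V] [DecidableEq V] (fV : V → ℕ) (fE : Sym2 V → ℕ)
    (x : V) :
    nfsdWeight ⊤ fV fE x = ∑ v, fV v + ∑ y ∈ univ.erase x, fE s(x, y) := by
  rw [nfsdWeight, ← add_sum_erase univ fV (mem_univ x), add_assoc, add_comm (∑ y ∈ _, fV y),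
    ← sum_add_distrib]
  congr 1
  refine sum_congr ?_ fun _ _ => rfl
  ext y
  simp [eq_comm]

theorem three_le_of_hasNFSD_top {k : ℕ} (h : HasNFSD (⊤ : SimpleGraph (Fin 3)) k) : 3 ≤ k := by
  obtain ⟨fV, fE, -, hE, hW⟩ := h
  have e01 := mem_Icc.1 (hE s(0, 1) (by simp))
  have e02 := mem_Icc.1 (hE s(0, 2) (by simp))
  have e12 := mem_Icc.1 (hE s(1, 2) (by simp))
  have w01 := hW 0 1 (by simp)
  have w02 := hW 0 2 (by simp)
  have w12 := hW 1 2 (by simp)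
  have h0 : univ.erase (0 : Fin 3) = {1, 2} := by decide
  have h1 : univ.erase (1 : Fin 3) = {0, 2} := by decide
  have h2 : univ.erase (2 : Fin 3) = {0, 1} := by decide
  simp only [nfsdWeight_top, h0, h1, h2] at w01 w02 w12
  rw [sum_pair (by decide), sum_pair (by decide)] at w01 w02 w12
  rw [Sym2.eq_swap (a := (1 : Fin 3)) (b := 0)] at w01 w12
  rw [Sym2.eq_swap (a := (2 : Fin 3)) (b := 0), Sym2.eq_swap (a := (2 : Fin 3)) (b := 1)]
    at w02 w12
  omega

theorem hasNFSD_top_three : HasNFSD (⊤ : SimpleGraph (Fin 3)) 3 := by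
  refine ⟨fun _ => 1, fun e => if e = s(0, 1) then 1 else if e = s(1, 2) then 2 else 3,
    by simp, fun e _ => ?_, ?_⟩
  · dsimp only
    split_ifs <;> simp
  · simp only [nfsdWeight_top, top_adj]
    decide

theorem stmt_4 :
    fgndi (SimpleGraph.cycleGraph 3) = 3 ∧
      HasNFSD (SimpleGraph.cycleGraph 3) 3 ∧ ¬ HasNFSD (SimpleGraph.cycleGraph 3) 2 := by
  rw [cycleGraph_three_eq_top]
  have hleast : IsLeast {k | HasNFSD (⊤ : SimpleGraph (Fin 3)) k} 3 :=
    ⟨hasNFSD_top_three, fun _ => three_le_of_hasNFSD_top⟩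
  exact ⟨hleast.csInf_eq, hasNFSD_top_three, fun h => absurd (three_le_of_hasNFSD_top h) (by simp)⟩
end

section
/- For every integer n ≥ 4, the cycle C_n on n vertices satisfies fgndi_Σ(C_n) = 2; that is, C_n admits an NFSD total 2-coloring but no NFSD total 1-coloring. -/
open SimpleGraph Finset

theorem cycleGraph_edge_injective (n : ℕ) :
    Function.Injective (fun i : Fin (n + 3) => s(i, i + 1)) := by
  intro i j h
  rcases Sym2.eq_iff.mp h with ⟨h, -⟩ | ⟨h₁, h₂⟩
  · exact h
  · exfalso
    have h2 : (1 : Fin (n + 3)) + 1 = 0 := by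
      have : j + (1 + 1) = j + 0 := by rw [← add_assoc, ← h₁, h₂, add_zero]
      exact add_left_cancel this
    have := congrArg Fin.val h2
    simp [Fin.val_add, Nat.mod_eq_of_lt] at this

theorem nfsdWeight_cycleGraph (n : ℕ) (fV : Fin (n + 3) → ℕ) (fE : Sym2 (Fin (n + 3)) → ℕ)
    (x : Fin (n + 3)) :
    nfsdWeight (cycleGraph (n + 3)) fV fE x =
      fV x + (fE s(x - 1, x) + fV (x - 1) + (fE s(x, x + 1) + fV (x + 1))) := by
  have hne : x - 1 ≠ x + 1 := by
    intro h
    have h' : x - 1 + 1 = x := sub_add_cancel x 1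
    have := cycleGraph_edge_injective n (a₁ := x - 1) (a₂ := x)
      (by simp only [h', ← h, Sym2.eq_swap])
    simp at this
  have hN : ∀ inst : DecidablePred (fun y => (cycleGraph (n + 3)).Adj x y),
      @Finset.filter _ (fun y => (cycleGraph (n + 3)).Adj x y) inst univ = {x - 1, x + 1} := by
    intro inst
    ext y
    have := Set.ext_iff.mp (cycleGraph_neighborSet (n := n + 1) (v := x)) y
    simpa using this
  unfold nfsdWeight
  rw [hN, Finset.sum_pair hne, Sym2.eq_swap (a := x) (b := x - 1)]

/-- A total coloring of a cycle, given as two sequences `v` (vertices) and `e` (edges, with `e i`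
the color of the edge from `i` to `i + 1`), is NFSD as soon as
`v i + e i ≠ v (i + 3) + e (i + 2)` for all `i`. -/
theorem hasNFSD_cycleGraph (n k : ℕ) (v e : Fin (n + 3) → ℕ)
    (hv : ∀ i, v i ∈ Finset.Icc 1 k) (he : ∀ i, e i ∈ Finset.Icc 1 k)
    (h : ∀ i, v i + e i ≠ v (i + 1 + 1 + 1) + e (i + 1 + 1)) :
    HasNFSD (cycleGraph (n + 3)) k := by
  let fE := Function.extend (fun i : Fin (n + 3) => s(i, i + 1)) e (fun _ => 1)
  have hE : ∀ i, fE s(i, i + 1) = e i := fun i =>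
    (cycleGraph_edge_injective n).extend_apply e _ i
  have key : ∀ x, nfsdWeight (cycleGraph (n + 3)) v fE x ≠
      nfsdWeight (cycleGraph (n + 3)) v fE (x + 1) := by
    intro x
    obtain ⟨i, rfl⟩ : ∃ i, x = i + 1 := ⟨x - 1, by simp⟩
    have := h i
    simp only [nfsdWeight_cycleGraph, add_sub_cancel_right, hE]
    omega
  have hadj : ∀ x y, (cycleGraph (n + 3)).Adj x y → x = y + 1 ∨ y = x + 1 := by
    intro x y hxy
    rw [cycleGraph_adj, sub_eq_iff_eq_add', sub_eq_iff_eq_add'] at hxy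
    simpa [add_comm] using hxy
  refine ⟨v, fE, hv, ?_, ?_⟩
  · intro s
    induction s with
    | h x y =>
      intro hxy
      rcases hadj x y hxy with rfl | rfl
      · rw [Sym2.eq_swap, hE]
        exact he _
      · rw [hE]
        exact he _
  · intro x y hxy
    rcases hadj x y hxy with rfl | rfl
    · exact (key y).symm
    · exact key x

theorem Fin.val_add_one_eq_ite (n : ℕ) (i : Fin (n + 3)) :
    (i + 1).val = if i.val = n + 2 then 0 else i.val + 1 := by
  rw [Fin.val_add_one]
  simp [Fin.ext_iff]

theorem hasNFSD_two_cycleGraph (n : ℕ) (hn : 1 ≤ n) : HasNFSD (cycleGraph (n + 3)) 2 := by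
  rcases Nat.even_or_odd' n with ⟨m, rfl | rfl⟩
  · refine hasNFSD_cycleGraph _ 2
      (fun i => if i.val = 0 ∨ (2 ≤ i.val ∧ i.val % 2 = 1) then 2 else 1)
      (fun i => if 2 ≤ i.val then 2 else 1) ?_ ?_ ?_
    · intro i
      simp only [Finset.mem_Icc]
      split_ifs <;> omega
    · intro i
      simp only [Finset.mem_Icc]
      split_ifs <;> omega
    · intro i
      have hi := i.isLt
      have h₁ := Fin.val_add_one_eq_ite _ i
      have h₂ := Fin.val_add_one_eq_ite _ (i + 1)
      have h₃ := Fin.val_add_one_eq_ite _ (i + 1 + 1)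
      generalize (i + 1 + 1 + 1).val = d at *
      generalize (i + 1 + 1).val = c at *
      generalize (i + 1).val = b at *
      generalize i.val = a at *
      split_ifs at h₁ h₂ h₃ ⊢ <;> omega
  · refine hasNFSD_cycleGraph _ 2 (fun i => i.val % 2 + 1) (fun _ => 1) ?_ ?_ ?_
    · intro i
      simp only [Finset.mem_Icc]
      omega
    · simp
    · intro i
      have hi := i.isLt
      have h₁ := Fin.val_add_one_eq_ite _ i
      have h₂ := Fin.val_add_one_eq_ite _ (i + 1)
      have h₃ := Fin.val_add_one_eq_ite _ (i + 1 + 1)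
      split_ifs at h₁ h₂ h₃ <;> omega

theorem not_hasNFSD_one_cycleGraph (n : ℕ) : ¬ HasNFSD (cycleGraph (n + 3)) 1 := by
  rintro ⟨fV, fE, hV, hE, h⟩
  have hadj : ∀ x : Fin (n + 3), (cycleGraph (n + 3)).Adj x (x + 1) := fun x => by
    rw [cycleGraph_adj]
    simp
  have hV' : ∀ x, fV x = 1 := fun x => by simpa using hV x
  have hE' : ∀ x, fE s(x, x + 1) = 1 := fun x => by
    simpa using hE s(x, x + 1) (hadj x)
  have hw : ∀ x, nfsdWeight (cycleGraph (n + 3)) fV fE x = 5 := fun x => by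
    have := hE' (x - 1)
    rw [sub_add_cancel] at this
    simp [nfsdWeight_cycleGraph, hV', hE', this]
  exact h 0 (0 + 1) (hadj 0) (by rw [hw, hw])

theorem stmt_5 (n : ℕ) (hn : 4 ≤ n) :
    fgndi (SimpleGraph.cycleGraph n) = 2 ∧
      HasNFSD (SimpleGraph.cycleGraph n) 2 ∧ ¬ HasNFSD (SimpleGraph.cycleGraph n) 1 := by
  obtain ⟨m, rfl⟩ : ∃ m, n = m + 3 := ⟨n - 3, by omega⟩
  have h2 := hasNFSD_two_cycleGraph m (by omega)
  have h1 := not_hasNFSD_one_cycleGraph m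
  refine ⟨le_antisymm (Nat.sInf_le h2) (le_csInf ⟨2, h2⟩ fun k hk => ?_), h2, h1⟩
  by_contra! hlt
  interval_cases k
  · exact not_hasNFSD_zero _ hk
  · exact h1 hk
end

section
/- Let G be a finite simple graph on n vertices and let m be a positive integer with m ≤ n. Then there exists a partition of the vertex set of G into m (possibly empty) classes such that, letting H be the spanning subgraph of G consisting of all edges of G whose endpoints lie in different classes, every vertex v of G satisfies (1 − 1/m)·d_G(v) ≤ d_H(v), where d_G(v) and d_H(v) denote the degrees of v in G and H respectively. -/
open SimpleGraph Finset

/-- A double sum of a symmetric function vanishing at `(v, v)`, split according to whether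
an index equals `v`. -/
theorem sum_sum_eq_sum_erase_add_of_symm {V : Type*} [Fintype V] [DecidableEq V]
    (f : V → V → ℕ) (hf : ∀ x y, f x y = f y x) (v : V) (hv : f v v = 0) :
    ∑ x, ∑ y, f x y =
      (∑ x ∈ univ.erase v, ∑ y ∈ univ.erase v, f x y) + 2 * ∑ y, f v y := by
  have h (x : V) : ∑ y, f x y = (∑ y ∈ univ.erase v, f x y) + f x v :=
    (sum_erase_add _ _ (mem_univ v)).symm
  rw [← sum_erase_add _ _ (mem_univ v), sum_congr rfl fun x _ => h x, sum_add_distrib,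
    sum_congr rfl fun x _ => hf x v, h v, hv]
  ring

/-- Some coloring gives every vertex at most as many neighbors of its own color as of any
other color. -/
theorem exists_coloring_card_adj_le {V α : Type*} [Fintype V] [Finite α] [Nonempty α]
    [DecidableEq α] (G : SimpleGraph V) [DecidableRel G.Adj] :
    ∃ c : V → α, ∀ (v : V) (j : α),
      #{u | G.Adj v u ∧ c u = c v} ≤ #{u | G.Adj v u ∧ c u = j} := by
  classical
  let f (c : V → α) (x y : V) : ℕ := if G.Adj x y ∧ c y = c x then 1 else 0
  have hf (c x y) : f c x y = f c y x := by simp only [f, G.adj_comm, eq_comm]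
  have hv (c v) : f c v v = 0 := by simp [f]
  obtain ⟨c, hc⟩ := Finite.exists_min fun c : V → α => ∑ x, ∑ y, f c x y
  refine ⟨c, fun v j => ?_⟩
  have h := hc (Function.update c v j)
  rw [sum_sum_eq_sum_erase_add_of_symm _ (hf _) v (hv _ _),
    sum_sum_eq_sum_erase_add_of_symm _ (hf _) v (hv _ _)] at h
  have hrest : ∑ x ∈ univ.erase v, ∑ y ∈ univ.erase v, f (Function.update c v j) x y =
      ∑ x ∈ univ.erase v, ∑ y ∈ univ.erase v, f c x y := by
    refine sum_congr rfl fun x hx => sum_congr rfl fun y hy => ?_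
    simp only [f, Function.update_of_ne (ne_of_mem_erase hx),
      Function.update_of_ne (ne_of_mem_erase hy)]
  have hnew : ∑ y, f (Function.update c v j) v y = #{u | G.Adj v u ∧ c u = j} := by
    rw [card_filter]
    refine sum_congr rfl fun y _ => ?_
    by_cases hy : y = v
    · simp [f, hy]
    · simp [f, Function.update_of_ne hy]
  have hold : ∑ y, f c v y = #{u | G.Adj v u ∧ c u = c v} := by rw [card_filter]
  omega

theorem stmt_6 {V : Type*} [Fintype V] (G : SimpleGraph V) [DecidableRel G.Adj]
    (m : ℕ) (hm : 1 ≤ m) (hmn : m ≤ Fintype.card V) :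
    ∃ c : V → Fin m, ∀ v : V,
      (m - 1) * G.degree v ≤
        m * (univ.filter (fun u => G.Adj v u ∧ c u ≠ c v)).card := by
  have : Nonempty (Fin m) := ⟨⟨0, hm⟩⟩
  obtain ⟨c, hc⟩ := exists_coloring_card_adj_le (α := Fin m) G
  refine ⟨c, fun v => ?_⟩
  have hsum : G.degree v = ∑ j, #{u | G.Adj v u ∧ c u = j} := by
    rw [← G.card_neighborFinset_eq_degree, neighborFinset_eq_filter,
      card_eq_sum_card_fiberwise (f := c) (t := univ) (by simp)]
    simp only [filter_filter]
  have hle : m * #{u | G.Adj v u ∧ c u = c v} ≤ G.degree v := by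
    rw [hsum]
    simpa using card_nsmul_le_sum univ _ _ fun j _ => hc v j
  have hsplit : G.degree v =
      #{u | G.Adj v u ∧ c u = c v} + #{u | G.Adj v u ∧ c u ≠ c v} := by
    rw [← G.card_neighborFinset_eq_degree, neighborFinset_eq_filter,
      ← card_filter_add_card_filter_not (fun u => c u = c v)]
    simp only [filter_filter, ne_eq]
  obtain ⟨k, rfl⟩ := Nat.exists_eq_add_of_le' hm
  rw [Nat.add_sub_cancel]
  nlinarith
end

section
/- Every connected 3-regular simple graph G satisfies 2 ≤ fgndi_Σ(G) ≤ 3; that is, G admits an NFSD total 3-coloring but no NFSD total 1-coloring. -/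
open SimpleGraph Finset

namespace SimpleGraph

variable {V : Type*} {G : SimpleGraph V}

/-- In a connected graph, a set containing `a` but not `b` has an edge leaving it. -/
theorem Connected.exists_adj_mem_notMem (hconn : G.Connected) {S : Set V} {a b : V}
    (ha : a ∈ S) (hb : b ∉ S) : ∃ v ∈ S, ∃ w ∉ S, G.Adj v w := by
  obtain ⟨p⟩ := hconn.preconnected a b
  obtain ⟨d, -, h₁, h₂⟩ := p.exists_boundary_dart S ha hb
  exact ⟨d.fst, h₁, d.snd, h₂, d.adj⟩

open scoped Classical in
/-- A connected graph of maximum degree at most three has a vertex coloring with three colors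
whose only possible monochromatic edge is a prescribed one. -/
theorem Connected.exists_coloring_except_edge [Fintype V] (hconn : G.Connected)
    (hdeg : ∀ v, #{y | G.Adj v y} ≤ 3) {r s : V} (hrs : G.Adj r s) :
    ∃ c : V → ZMod 3, ∀ x y, G.Adj x y → s(x, y) ≠ s(r, s) → c x ≠ c y := by
  suffices h : ∀ S : Finset V, ∃ c : V → ZMod 3,
      ∀ x ∈ S, ∀ y ∈ S, G.Adj x y → s(x, y) ≠ s(r, s) → c x ≠ c y by
    obtain ⟨c, hc⟩ := h univ
    exact ⟨c, fun x y => hc x (mem_univ x) y (mem_univ y)⟩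
  intro S
  induction S using Finset.strongInduction with
  | H S ih =>
    rcases S.eq_empty_or_nonempty with rfl | ⟨z, hz⟩
    · exact ⟨0, by simp⟩
    obtain ⟨v, hv, w, hvw, hw⟩ : ∃ v ∈ S, ∃ w, G.Adj v w ∧ (w ∈ S → s(v, w) = s(r, s)) := by
      by_cases hr : r ∈ S
      · exact ⟨r, hr, s, hrs, fun _ => rfl⟩
      · obtain ⟨v, hv, w, hw, hvw⟩ :=
          hconn.exists_adj_mem_notMem (S := (S : Set V)) (by simpa using hz) (by simpa using hr)
        exact ⟨v, by simpa using hv, w, hvw, fun h => absurd h (by simpa using hw)⟩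
    obtain ⟨c, hc⟩ := ih (S.erase v) (erase_ssubset hv)
    obtain ⟨k, hk⟩ : ∃ k, k ∉ ((univ.filter (fun y => G.Adj v y)).erase w).image c := by
      by_contra! h
      have h₁ : #(univ : Finset (ZMod 3)) ≤ #((univ.filter (fun y => G.Adj v y)).erase w) :=
        (card_le_card fun k _ => h k).trans card_image_le
      rw [card_erase_of_mem (by simpa using hvw), card_univ, ZMod.card] at h₁
      have := hdeg v
      omega
    have hk' : ∀ y ∈ S, G.Adj v y → s(v, y) ≠ s(r, s) → k ≠ c y := by
      rintro y hy hvy hne rfl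
      refine hk (mem_image_of_mem c (mem_erase.2 ⟨?_, by simpa using hvy⟩))
      rintro rfl
      exact hne (hw hy)
    refine ⟨Function.update c v k, fun x hx y hy hxy hne => ?_⟩
    rcases eq_or_ne x v with rfl | hxv
    · rw [Function.update_self, Function.update_of_ne hxy.ne']
      exact hk' y hy hxy hne
    rcases eq_or_ne y v with rfl | hyv
    · rw [Function.update_self, Function.update_of_ne hxy.ne]
      exact (hk' x hx hxy.symm (by rwa [Sym2.eq_swap])).symm
    · rw [Function.update_of_ne hxv, Function.update_of_ne hyv]
      exact hc x (mem_erase.2 ⟨hxv, hx⟩) y (mem_erase.2 ⟨hyv, hy⟩) hxy hne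

open scoped Classical in
/-- The linear map sending vertex and edge colors to vertex weights. -/
noncomputable def fullWeight [Fintype V] (G : SimpleGraph V) (R : Type*) [CommRing R] :
    ((V → R) × (Sym2 V → R)) →ₗ[R] (V → R) where
  toFun p x := p.1 x + ∑ y ∈ univ.filter (fun y => G.Adj x y), (p.2 s(x, y) + p.1 y)
  map_add' p q := by
    ext x
    simp only [Prod.fst_add, Prod.snd_add, Pi.add_apply, sum_add_distrib]
    ring
  map_smul' t p := by
    ext x
    simp only [Prod.smul_fst, Prod.smul_snd, Pi.smul_apply, smul_eq_mul, RingHom.id_apply,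
      mul_add, mul_sum]

open scoped Classical in
theorem fullWeight_apply [Fintype V] {R : Type*} [CommRing R] (p : (V → R) × (Sym2 V → R))
    (x : V) : G.fullWeight R p x =
      p.1 x + ∑ y ∈ univ.filter (fun y => G.Adj x y), (p.2 s(x, y) + p.1 y) := rfl

open scoped Classical in
theorem fullWeight_single_vertex [Fintype V] {R : Type*} [CommRing R] (v : V) :
    G.fullWeight R (Pi.single v 1, 0) =
      Pi.single v 1 + ∑ y ∈ univ.filter (fun y => G.Adj v y), Pi.single y 1 := by
  ext x
  simp [fullWeight_apply, Pi.single_apply, Finset.sum_apply, G.adj_comm]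

open scoped Classical in
theorem fullWeight_single_edge [Fintype V] {R : Type*} [CommRing R] {v w : V} (h : G.Adj v w) :
    G.fullWeight R (0, Pi.single s(v, w) 1) = Pi.single v 1 + Pi.single w 1 := by
  ext x
  simp only [fullWeight_apply, Pi.zero_apply, add_zero, zero_add, Pi.single_apply, Pi.add_apply]
  rcases eq_or_ne x v with rfl | hv
  · simp [h, h.ne]
  rcases eq_or_ne x w with rfl | hw
  · simp [h.symm, h.ne']
  · simp [hv, hw]

open scoped Classical in
/-- If the only functional orthogonal to the free vertices and edges is zero, then any weights can
be realized with prescribed colors on the remaining vertices and edges. -/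
theorem exists_fullWeight_eq [Fintype V] {K : Type*} [Field K] (PV : V → Prop) (PE : Sym2 V → Prop)
    (h : ∀ l : V → K, (∀ v, PV v → l v + ∑ y ∈ univ.filter (fun y => G.Adj v y), l y = 0) →
      (∀ x y, G.Adj x y → PE s(x, y) → l x + l y = 0) → ∀ x, l x = 0)
    (a₀ : V → K) (b₀ : Sym2 V → K) (c : V → K) :
    ∃ a b, (∀ v, ¬ PV v → a v = a₀ v) ∧ (∀ e, ¬ PE e → b e = b₀ e) ∧
      G.fullWeight K (a, b) = c := by
  let W : Submodule K ((V → K) × (Sym2 V → K)) :=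
    { carrier := {p | (∀ v, ¬ PV v → p.1 v = 0) ∧ ∀ e, ¬ PE e → p.2 e = 0}
      add_mem' := by
        rintro p q ⟨hp, hp'⟩ ⟨hq, hq'⟩
        exact ⟨fun v hv => by simp [hp v hv, hq v hv], fun e he => by simp [hp' e he, hq' e he]⟩
      zero_mem' := by simp
      smul_mem' := by
        rintro t p ⟨hp, hp'⟩
        exact ⟨fun v hv => by simp [hp v hv], fun e he => by simp [hp' e he]⟩ }
  have hW : W.map (G.fullWeight K) = ⊤ := by
    by_contra hne
    obtain ⟨f, hf, hker⟩ := Submodule.exists_le_ker_of_lt_top _ (lt_top_iff_ne_top.2 hne)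
    have hf' : ∀ p ∈ W, f (G.fullWeight K p) = 0 := fun p hp =>
      hker (Submodule.mem_map_of_mem hp)
    refine hf (LinearMap.pi_ext' fun x => LinearMap.ext_ring ?_)
    refine h (fun x => f (Pi.single x 1)) (fun v hv => ?_) (fun x y hxy he => ?_) x
    · rw [← map_sum, ← map_add, ← fullWeight_single_vertex]
      refine hf' _ ⟨fun w hw => ?_, fun _ _ => rfl⟩
      have hwv : w ≠ v := by
        rintro rfl
        exact hw hv
      simp [hwv]
    · rw [← map_add, ← fullWeight_single_edge hxy]
      refine hf' _ ⟨fun _ _ => rfl, fun e he' => ?_⟩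
      have hne : e ≠ s(x, y) := by
        rintro rfl
        exact he' he
      simp [hne]
  obtain ⟨p, ⟨hp, hp'⟩, hpc⟩ : c - G.fullWeight K (a₀, b₀) ∈ W.map (G.fullWeight K) :=
    hW ▸ Submodule.mem_top
  refine ⟨p.1 + a₀, p.2 + b₀, fun v hv => by simp [hp v hv], fun e he => by simp [hp' e he], ?_⟩
  rw [← Prod.mk_add_mk, map_add, Prod.mk.eta, hpc, sub_add_cancel]

open scoped Classical in
theorem exists_filter_adj_eq [Fintype V] (hreg : ∀ v, #{y | G.Adj v y} = 3) {x a : V}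
    (h : G.Adj x a) : ∃ b c, a ≠ b ∧ a ≠ c ∧ b ≠ c ∧
      univ.filter (fun y => G.Adj x y) = {a, b, c} := by
  have ha : a ∈ univ.filter (fun y => G.Adj x y) := by simpa using h
  have h2 : #((univ.filter (fun y => G.Adj x y)).erase a) = 2 := by
    rw [card_erase_of_mem ha, hreg]
  obtain ⟨b, c, hbc, hE⟩ := card_eq_two.1 h2
  have hb : b ∈ (univ.filter (fun y => G.Adj x y)).erase a := by simp [hE]
  have hc : c ∈ (univ.filter (fun y => G.Adj x y)).erase a := by simp [hE]
  exact ⟨b, c, (mem_erase.1 hb).1.symm, (mem_erase.1 hc).1.symm, hbc, by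
    rw [← insert_erase ha, hE]⟩

open scoped Classical in
/-- A connected cubic graph in which every edge lies in a triangle is complete on four vertices. -/
theorem Connected.eq_four_of_common_neighbor [Fintype V] (hconn : G.Connected)
    (hreg : ∀ v, #{y | G.Adj v y} = 3)
    (htri : ∀ x y, G.Adj x y → ∃ z, G.Adj x z ∧ G.Adj y z) :
    ∃ a b c d : V, a ≠ b ∧ a ≠ c ∧ a ≠ d ∧ b ≠ c ∧ b ≠ d ∧ c ≠ d ∧
      (∀ x, x = a ∨ x = b ∨ x = c ∨ x = d) ∧ ∀ x y, G.Adj x y ↔ x ≠ y := by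
  obtain ⟨a⟩ := hconn.nonempty
  obtain ⟨b₀, hb₀⟩ : ∃ b, G.Adj a b := by
    have : (univ.filter (fun y => G.Adj a y)).Nonempty := card_pos.1 (by rw [hreg]; norm_num)
    simpa using this.exists_mem
  obtain ⟨b, c, d, hbc, hbd, hcd, hab, hac, had, hbc', hbd', ha⟩ : ∃ b c d, b ≠ c ∧ b ≠ d ∧ c ≠ d ∧
      G.Adj a b ∧ G.Adj a c ∧ G.Adj a d ∧ G.Adj b c ∧ G.Adj b d ∧
        ∀ y, G.Adj a y → y = b ∨ y = c ∨ y = d := by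
    obtain ⟨c₀, d₀, hbc, hbd, hcd, h⟩ := exists_filter_adj_eq hreg hb₀
    have hm : ∀ y, G.Adj a y ↔ y = b₀ ∨ y = c₀ ∨ y = d₀ := fun y => by
      simpa using Finset.ext_iff.1 h y
    have h₁ := htri a b₀ (by simp [hm])
    have h₂ := htri a c₀ (by simp [hm])
    have h₃ := htri a d₀ (by simp [hm])
    have key : (G.Adj b₀ c₀ ∧ G.Adj b₀ d₀) ∨ (G.Adj c₀ b₀ ∧ G.Adj c₀ d₀) ∨
        (G.Adj d₀ b₀ ∧ G.Adj d₀ c₀) := by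
      simp only [hm, or_and_right, exists_or, exists_eq_left, G.irrefl, false_or, or_false] at h₁ h₂ h₃
      have e₁ := G.adj_comm b₀ c₀
      have e₂ := G.adj_comm b₀ d₀
      have e₃ := G.adj_comm c₀ d₀
      tauto
    rcases key with ⟨h, h'⟩ | ⟨h, h'⟩ | ⟨h, h'⟩
    · exact ⟨b₀, c₀, d₀, hbc, hbd, hcd, by simp [hm], by simp [hm], by simp [hm], h, h',
        fun y hy => (hm y).1 hy⟩
    · exact ⟨c₀, b₀, d₀, hbc.symm, hcd, hbd, by simp [hm], by simp [hm], by simp [hm], h, h',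
        fun y hy => by have := (hm y).1 hy; tauto⟩
    · exact ⟨d₀, b₀, c₀, hbd.symm, hcd.symm, hbc, by simp [hm], by simp [hm], by simp [hm], h, h',
        fun y hy => by have := (hm y).1 hy; tauto⟩
  have nbrs : ∀ x p q r, p ≠ q → p ≠ r → q ≠ r → G.Adj x p → G.Adj x q → G.Adj x r →
      ∀ y, G.Adj x y → y = p ∨ y = q ∨ y = r := by
    intro x p q r hpq hpr hqr hp hq hr y hy
    have : ({p, q, r} : Finset V) = univ.filter (fun y => G.Adj x y) :=
      eq_of_subset_of_card_le (by simp [insert_subset_iff, hp, hq, hr])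
        (by rw [hreg, card_eq_three.2 ⟨p, q, r, hpq, hpr, hqr, rfl⟩])
    have hy' : y ∈ ({p, q, r} : Finset V) := by simpa [this] using hy
    simpa using hy'
  have hb := nbrs b a c d hac.ne had.ne hcd hab.symm hbc' hbd'
  have hcd' : G.Adj c d := by
    by_contra hcd'
    obtain ⟨e, f, hae, haf, hef, h⟩ := exists_filter_adj_eq hreg hac.symm
    have hm : ∀ y, G.Adj c y ↔ y = a ∨ y = e ∨ y = f := fun y => by
      simpa using Finset.ext_iff.1 h y
    obtain ⟨g, hcg, hga, hgb⟩ : ∃ g, G.Adj c g ∧ g ≠ a ∧ g ≠ b := by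
      by_cases heb : e = b
      · exact ⟨f, by simp [hm], haf.symm, fun h => hef (heb.trans h.symm)⟩
      · exact ⟨e, by simp [hm], hae.symm, heb⟩
    have hgc := hcg.ne'
    have hgd : g ≠ d := by rintro rfl; exact hcd' hcg
    obtain ⟨z, hz, hgz⟩ := htri c g hcg
    have hza : z ≠ a := by
      rintro rfl
      have := ha g hgz.symm
      tauto
    have hzb : z ≠ b := by
      rintro rfl
      have := hb g hgz.symm
      tauto
    have := nbrs c a b g hab.ne hga.symm hgb.symm hac.symm hbc'.symm hcg z hz
    have := hgz.ne'
    tauto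
  have hc := nbrs c a b d hab.ne had.ne hbd hac.symm hbc'.symm hcd'
  have hd := nbrs d a b c hab.ne hac.ne hbc had.symm hbd'.symm hcd'.symm
  have huniv : ∀ x, x = a ∨ x = b ∨ x = c ∨ x = d := by
    by_contra! hx
    obtain ⟨x, hx⟩ := hx
    obtain ⟨v, hv, w, hw, hvw⟩ := hconn.exists_adj_mem_notMem
      (S := {x | x = a ∨ x = b ∨ x = c ∨ x = d}) (a := a) (b := x) (by simp) (by simpa using hx)
    rcases hv with rfl | rfl | rfl | rfl
    · have := ha w hvw; exact hw (by simp only [Set.mem_ofPred_eq]; tauto)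
    · have := hb w hvw; exact hw (by simp only [Set.mem_ofPred_eq]; tauto)
    · have := hc w hvw; exact hw (by simp only [Set.mem_ofPred_eq]; tauto)
    · have := hd w hvw; exact hw (by simp only [Set.mem_ofPred_eq]; tauto)
  refine ⟨a, b, c, d, hab.ne, hac.ne, had.ne, hbc, hbd, hcd, huniv, fun x y => ⟨Adj.ne, ?_⟩⟩
  rcases huniv x with rfl | rfl | rfl | rfl <;> rcases huniv y with rfl | rfl | rfl | rfl <;>
    simp [*, Adj.symm]

end SimpleGraph

/-- The representative in `{1, 2, 3}` of a residue class modulo three. -/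
def ZMod.toColor (z : ZMod 3) : ℕ := if z = 0 then 3 else z.val

theorem ZMod.toColor_mem (z : ZMod 3) : z.toColor ∈ Finset.Icc 1 3 := by
  revert z
  decide

theorem ZMod.natCast_toColor (z : ZMod 3) : (z.toColor : ZMod 3) = z := by
  revert z
  decide

theorem natCast_nfsdWeight {V : Type*} [Fintype V] (G : SimpleGraph V) (R : Type*) [CommRing R]
    (fV : V → ℕ) (fE : Sym2 V → ℕ) (x : V) :
    (nfsdWeight G fV fE x : R) =
      G.fullWeight R (fun v => (fV v : R), fun e => (fE e : R)) x := by
  simp [nfsdWeight, fullWeight_apply]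

open scoped Classical in
theorem nfsdWeight_eq_of_filter_adj {V : Type*} [Fintype V] {G : SimpleGraph V}
    (fV : V → ℕ) (fE : Sym2 V → ℕ) {x p q r : V} (hpq : p ≠ q) (hpr : p ≠ r) (hqr : q ≠ r)
    (h : univ.filter (fun y => G.Adj x y) = {p, q, r}) :
    nfsdWeight G fV fE x =
      fV x + (fE s(x, p) + fV p + (fE s(x, q) + fV q) + (fE s(x, r) + fV r)) := by
  rw [nfsdWeight, h, sum_insert (by simp [hpq, hpr]), sum_pair hqr, add_assoc (fE _ + fV _)]

open scoped Classical in
/-- In a cubic graph, let `p, q` be the further neighbors of `r` and `u, v` those of `s`, for an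
edge `rs` in no triangle. No nonzero functional is orthogonal to all vertices other than `p` and
to all edges other than `rp`, `rq`, `su`, `sv`. -/
theorem eq_zero_of_orthogonal {V : Type*} [Fintype V] {G : SimpleGraph V}
    (hreg : ∀ v, #{y | G.Adj v y} = 3) {r s p q u v : V} (hrs : G.Adj r s)
    (hrp : G.Adj r p) (hrq : G.Adj r q) (hsu : G.Adj s u) (hsv : G.Adj s v)
    (hNr : univ.filter (fun y => G.Adj r y) = {s, p, q})
    (hNs : univ.filter (fun y => G.Adj s y) = {r, u, v})
    (hpq : p ≠ q) (huv : u ≠ v) (hpu : p ≠ u) (hpv : p ≠ v) (hqu : q ≠ u) (hqv : q ≠ v)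
    {l : V → ZMod 3}
    (hV : ∀ x, x ≠ p → l x + ∑ y ∈ univ.filter (fun y => G.Adj x y), l y = 0)
    (hE : ∀ x y, G.Adj x y →
      s(x, y) ≠ s(r, p) ∧ s(x, y) ≠ s(r, q) ∧ s(x, y) ≠ s(s, u) ∧ s(x, y) ≠ s(s, v) →
      l x + l y = 0) (x : V) : l x = 0 := by
  have three : (3 : ZMod 3) = 0 := by decide
  have hsp : s ≠ p := by
    rintro rfl
    have : #{y | G.Adj r y} ≤ 2 := by rw [hNr]; simpa using card_le_two
    rw [hreg] at this
    omega
  have hsq : s ≠ q := by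
    rintro rfl
    have : #{y | G.Adj r y} ≤ 2 := by
      rw [hNr, insert_eq_self.2 (by simp)]; exact card_le_two
    rw [hreg] at this
    omega
  have hru : r ≠ u := by
    rintro rfl
    have : #{y | G.Adj s y} ≤ 2 := by rw [hNs]; simpa using card_le_two
    rw [hreg] at this
    omega
  have hrv : r ≠ v := by
    rintro rfl
    have : #{y | G.Adj s y} ≤ 2 := by
      rw [hNs, insert_eq_self.2 (by simp)]; exact card_le_two
    rw [hreg] at this
    omega
  have outer : ∀ x y, x ≠ p → x ≠ r → x ≠ s → G.Adj x y →
      (∀ z, G.Adj x z → z ≠ y → s(x, z) ≠ s(r, q) ∧ s(x, z) ≠ s(s, u) ∧ s(x, z) ≠ s(s, v)) →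
      l y = l x := by
    intro x y hxp hxr hxs hxy h
    obtain ⟨z, w, hyz, hyw, hzw, hN⟩ := exists_filter_adj_eq hreg hxy
    have hxz : G.Adj x z := by
      have : z ∈ univ.filter (fun y => G.Adj x y) := by simp [hN]
      simpa using this
    have hxw : G.Adj x w := by
      have : w ∈ univ.filter (fun y => G.Adj x y) := by simp [hN]
      simpa using this
    have hp : ∀ z, s(x, z) ≠ s(r, p) := fun z => by simp [hxp, hxr]
    have e₁ := hE x z hxz ⟨hp z, h z hxz hyz.symm⟩
    have e₂ := hE x w hxw ⟨hp w, h w hxw hyw.symm⟩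
    have e₃ := hV x hxp
    rw [hN, sum_insert (by simp [hyz, hyw]), sum_pair hzw] at e₃
    linear_combination e₃ - e₁ - e₂
  have hlq : l r = l q := outer q r hpq.symm hrq.ne' hsq.symm hrq.symm fun z _ hz => by
    simp [hz, hrq.ne', hsq.symm, hqu, hqv]
  have hlu : l s = l u := outer u s hpu.symm hru.symm hsu.ne' hsu.symm fun z _ hz => by
    simp [hz, hru.symm, hqu.symm, hsu.ne', huv]
  have hlv : l s = l v := outer v s hpv.symm hrv.symm hsv.ne' hsv.symm fun z _ hz => by
    simp [hz, hrv.symm, hqv.symm, hsv.ne', huv.symm]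
  have hlrs := hE r s hrs (by simp [hrs.ne, hrs.ne', hsp, hsq, hru, hrv])
  have er := hV r hrp.ne
  have es := hV s hsp
  rw [hNr, sum_insert (by simp [hsp, hsq]), sum_pair hpq] at er
  rw [hNs, sum_insert (by simp [hru, hrv]), sum_pair huv] at es
  have hls : l s = 0 := by linear_combination hlrs - es - hlu - hlv + l s * three
  have hlr : l r = 0 := by linear_combination hlrs - hls
  have hlp : l p = 0 := by linear_combination er - hlrs + hlq - hlr
  by_cases hxr : x = r
  · rw [hxr, hlr]
  by_cases hxs : x = s
  · rw [hxs, hls]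
  by_cases hxp : x = p
  · rw [hxp, hlp]
  by_cases hxq : x = q
  · rw [hxq, ← hlq, hlr]
  by_cases hxu : x = u
  · rw [hxu, ← hlu, hls]
  by_cases hxv : x = v
  · rw [hxv, ← hlv, hls]
  obtain ⟨y, hy⟩ : (univ.filter (fun y => G.Adj x y)).Nonempty :=
    card_pos.1 (by rw [hreg]; norm_num)
  have hxy : G.Adj x y := by simpa using hy
  have e₁ := outer x y hxp hxr hxs hxy fun z _ _ => by simp [hxr, hxs, hxq, hxu, hxv]
  have e₂ := hE x y hxy (by simp [hxr, hxs, hxp, hxq, hxu, hxv])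
  linear_combination l x * three - e₂ + e₁

open scoped Classical in
/-- A connected cubic graph with an edge in no triangle has an NFSD total 3-coloring. -/
theorem hasNFSD_three_of_no_common_neighbor {V : Type*} [Fintype V] {G : SimpleGraph V}
    (hconn : G.Connected) (hreg : ∀ v, #{y | G.Adj v y} = 3) {r s : V}
    (hrs : G.Adj r s) (hno : ∀ z, G.Adj r z → ¬ G.Adj s z) : HasNFSD G 3 := by
  obtain ⟨c, hc⟩ := hconn.exists_coloring_except_edge (fun v => (hreg v).le) hrs
  obtain ⟨p, q, hsp, hsq, hpq, hNr⟩ := exists_filter_adj_eq hreg hrs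
  obtain ⟨u, v, hru, hrv, huv, hNs⟩ := exists_filter_adj_eq hreg hrs.symm
  have hr : ∀ y, G.Adj r y ↔ y = s ∨ y = p ∨ y = q := fun y => by
    simpa using Finset.ext_iff.1 hNr y
  have hs : ∀ y, G.Adj s y ↔ y = r ∨ y = u ∨ y = v := fun y => by
    simpa using Finset.ext_iff.1 hNs y
  have hrp : G.Adj r p := by simp [hr]
  have hrq : G.Adj r q := by simp [hr]
  have hsu : G.Adj s u := by simp [hs]
  have hsv : G.Adj s v := by simp [hs]
  have hpu : p ≠ u := by rintro rfl; exact hno _ hrp hsu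
  have hpv : p ≠ v := by rintro rfl; exact hno _ hrp hsv
  have hqu : q ≠ u := by rintro rfl; exact hno _ hrq hsu
  have hqv : q ≠ v := by rintro rfl; exact hno _ hrq hsv
  obtain ⟨a, b, ha, hb, hab⟩ := exists_fullWeight_eq (G := G) (K := ZMod 3) (fun x => x ≠ p)
    (fun e => e ≠ s(r, p) ∧ e ≠ s(r, q) ∧ e ≠ s(s, u) ∧ e ≠ s(s, v))
    (fun l hV hE => eq_zero_of_orthogonal hreg hrs hrp hrq hsu hsv hNr hNs hpq huv
      hpu hpv hqu hqv hV hE) 0 (fun e => if r ∈ e then 0 else 1) c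
  have hw : ∀ x, ((nfsdWeight G (fun v => (a v).toColor) (fun e => (b e).toColor) x : ℕ) : ZMod 3) =
      c x := fun x => by
    simp only [natCast_nfsdWeight, ZMod.natCast_toColor, hab]
  have hlt : nfsdWeight G (fun v => (a v).toColor) (fun e => (b e).toColor) s <
      nfsdWeight G (fun v => (a v).toColor) (fun e => (b e).toColor) r := by
    have hap : a p = 0 := ha p (by simp)
    have hbp : b s(r, p) = 0 := by rw [hb _ (by simp)]; simp
    have hbq : b s(r, q) = 0 := by rw [hb _ (by simp)]; simp
    have hbu : b s(s, u) = 1 := by rw [hb _ (by simp)]; simp [hrs.ne, hru]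
    have hbv : b s(s, v) = 1 := by rw [hb _ (by simp)]; simp [hrs.ne, hrv]
    have h₁ := Finset.mem_Icc.1 (ZMod.toColor_mem (a q))
    have h₂ := Finset.mem_Icc.1 (ZMod.toColor_mem (a u))
    have h₃ := Finset.mem_Icc.1 (ZMod.toColor_mem (a v))
    have t₀ : ZMod.toColor 0 = 3 := by decide
    have t₁ : ZMod.toColor 1 = 1 := by decide
    have e₁ := nfsdWeight_eq_of_filter_adj (fun v => (a v).toColor) (fun e => (b e).toColor)
      hsp hsq hpq hNr
    have e₂ := nfsdWeight_eq_of_filter_adj (fun v => (a v).toColor) (fun e => (b e).toColor)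
      hru hrv huv hNs
    simp only [hap, hbp, hbq, hbu, hbv, t₀, t₁, Sym2.eq_swap (a := s) (b := r)] at e₁ e₂
    omega
  refine ⟨_, _, fun v => (a v).toColor_mem, fun e _ => (b e).toColor_mem, fun x y hxy heq => ?_⟩
  by_cases hxy' : s(x, y) = s(r, s)
  · rcases Sym2.eq_iff.1 hxy' with ⟨rfl, rfl⟩ | ⟨rfl, rfl⟩
    · exact hlt.ne' heq
    · exact hlt.ne heq
  · exact hc x y hxy hxy' (by rw [← hw x, ← hw y, heq])

open scoped Classical in
theorem hasNFSD_three_of_four {V : Type*} [Fintype V] {G : SimpleGraph V} {a b c d : V}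
    (hab : a ≠ b) (hac : a ≠ c) (had : a ≠ d) (hbc : b ≠ c) (hbd : b ≠ d) (hcd : c ≠ d)
    (huniv : ∀ x, x = a ∨ x = b ∨ x = c ∨ x = d) (hadj : ∀ x y, G.Adj x y ↔ x ≠ y) :
    HasNFSD G 3 := by
  let fE : Sym2 V → ℕ := fun e => if e = s(b, d) then 2 else if e = s(c, d) then 3 else 1
  have ha : univ.filter (fun y => G.Adj a y) = {b, c, d} := by
    ext y; rcases huniv y with rfl | rfl | rfl | rfl <;> simp [*]
  have hb : univ.filter (fun y => G.Adj b y) = {a, c, d} := by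
    ext y; rcases huniv y with rfl | rfl | rfl | rfl <;> simp [*, Ne.symm]
  have hc : univ.filter (fun y => G.Adj c y) = {a, b, d} := by
    ext y; rcases huniv y with rfl | rfl | rfl | rfl <;> simp [*, Ne.symm]
  have hd : univ.filter (fun y => G.Adj d y) = {a, b, c} := by
    ext y; rcases huniv y with rfl | rfl | rfl | rfl <;> simp [*, Ne.symm]
  have wa : nfsdWeight G 1 fE a = 7 := by
    rw [nfsdWeight_eq_of_filter_adj _ _ hbc hbd hcd ha]
    simp [fE, *, Ne.symm]
  have wb : nfsdWeight G 1 fE b = 8 := by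
    rw [nfsdWeight_eq_of_filter_adj _ _ hac had hcd hb]
    simp [fE, *, Ne.symm]
  have wc : nfsdWeight G 1 fE c = 9 := by
    rw [nfsdWeight_eq_of_filter_adj _ _ hab had hbd hc]
    simp [fE, *, Ne.symm]
  have wd : nfsdWeight G 1 fE d = 10 := by
    rw [nfsdWeight_eq_of_filter_adj _ _ hab hac hbc hd]
    simp [fE, *, Ne.symm]
  refine ⟨1, fE, by simp, fun e _ => ?_, fun x y hxy => ?_⟩
  · simp only [fE]
    split_ifs <;> simp
  · rcases huniv x with rfl | rfl | rfl | rfl <;> rcases huniv y with rfl | rfl | rfl | rfl <;>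
      simp_all

open scoped Classical in
theorem not_hasNFSD_one {V : Type*} [Fintype V] {G : SimpleGraph V}
    (hreg : ∀ v, #{y | G.Adj v y} = 3) {x y : V} (hxy : G.Adj x y) : ¬ HasNFSD G 1 := by
  rintro ⟨fV, fE, hV, hE, h⟩
  have hw : ∀ z, nfsdWeight G fV fE z = 7 := fun z => by
    have hV' : ∀ v, fV v = 1 := fun v => by simpa using hV v
    rw [nfsdWeight, hV', sum_congr rfl (g := fun _ => 2), sum_const, hreg]
    · rfl
    · intro w hw
      rw [hV', show fE s(z, w) = 1 by simpa using hE s(z, w) (by simpa using hw)]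
  exact h x y hxy ((hw x).trans (hw y).symm)

theorem stmt_7 {V : Type*} [Fintype V] (G : SimpleGraph V) [DecidableRel G.Adj]
    (hconn : G.Connected) (hreg : ∀ v : V, G.degree v = 3) :
    2 ≤ fgndi G ∧ fgndi G ≤ 3 ∧ HasNFSD G 3 ∧ ¬ HasNFSD G 1 := by
  classical
  have hreg' : ∀ v, #{y | G.Adj v y} = 3 := fun v => by
    rw [← hreg v, ← card_neighborFinset_eq_degree, neighborFinset_eq_filter]
  have h₃ : HasNFSD G 3 := by
    by_cases h : ∃ r s, G.Adj r s ∧ ∀ z, G.Adj r z → ¬ G.Adj s z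
    · obtain ⟨r, s, hrs, hno⟩ := h
      exact hasNFSD_three_of_no_common_neighbor hconn (fun v => by convert hreg' v) hrs hno
    · push Not at h
      obtain ⟨a, b, c, d, hab, hac, had, hbc, hbd, hcd, huniv, hadj⟩ :=
        hconn.eq_four_of_common_neighbor (fun v => by convert hreg' v) h
      exact hasNFSD_three_of_four hab hac had hbc hbd hcd huniv hadj
  have := hconn.nonempty
  have h₁ : ¬ HasNFSD G 1 := by
    obtain ⟨y, hy⟩ := (G.degree_pos_iff_exists_adj (Classical.arbitrary V)).1 (by simp [hreg])
    exact not_hasNFSD_one (fun v => by convert hreg' v) hy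
  refine ⟨?_, Nat.sInf_le h₃, h₃, h₁⟩
  have hmem : HasNFSD G (fgndi G) := Nat.sInf_mem (s := {k | HasNFSD G k}) ⟨3, h₃⟩
  by_contra! hlt
  have hcases : fgndi G = 0 ∨ fgndi G = 1 := by omega
  rcases hcases with h | h <;> rw [h] at hmem
  · exact not_hasNFSD_zero G hmem
  · exact h₁ hmem
end

section
/- For every integer n ≥ 2, the complete bipartite graph K_{n,n} with both part sizes equal to n satisfies fgndi_Σ(K_{n,n}) = 2; that is, K_{n,n} admits an NFSD total 2-coloring but no NFSD total 1-coloring. -/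
open SimpleGraph Finset

theorem nfsdWeight_completeBipartiteGraph_inl {α β : Type*} [Fintype α] [Fintype β]
    (fV : α ⊕ β → ℕ) (fE : Sym2 (α ⊕ β) → ℕ) (x : α) :
    nfsdWeight (completeBipartiteGraph α β) fV fE (Sum.inl x) =
      fV (Sum.inl x) + ∑ y : β, (fE s(Sum.inl x, Sum.inr y) + fV (Sum.inr y)) := by
  simp [nfsdWeight, Finset.sum_filter, Fintype.sum_sum_type]

theorem nfsdWeight_completeBipartiteGraph_inr {α β : Type*} [Fintype α] [Fintype β]
    (fV : α ⊕ β → ℕ) (fE : Sym2 (α ⊕ β) → ℕ) (y : β) :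
    nfsdWeight (completeBipartiteGraph α β) fV fE (Sum.inr y) =
      fV (Sum.inr y) + ∑ x : α, (fE s(Sum.inr y, Sum.inl x) + fV (Sum.inl x)) := by
  simp [nfsdWeight, Finset.sum_filter, Fintype.sum_sum_type]

theorem not_hasNFSD_one_completeBipartiteGraph (n : ℕ) (hn : 0 < n) :
    ¬ HasNFSD (completeBipartiteGraph (Fin n) (Fin n)) 1 := by
  rintro ⟨fV, fE, hV, hE, hW⟩
  have hV' : ∀ v, fV v = 1 := fun v => by simpa using hV v
  have hE' : ∀ x y, (completeBipartiteGraph (Fin n) (Fin n)).Adj x y → fE s(x, y) = 1 :=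
    fun x y hxy => by simpa using hE s(x, y) hxy
  have hlr : ∀ x y : Fin n, fE s(Sum.inl x, Sum.inr y) = 1 := fun x y => hE' _ _ (by simp)
  have hrl : ∀ x y : Fin n, fE s(Sum.inr x, Sum.inl y) = 1 := fun x y => hE' _ _ (by simp)
  refine hW (Sum.inl ⟨0, hn⟩) (Sum.inr ⟨0, hn⟩) (by simp) ?_
  rw [nfsdWeight_completeBipartiteGraph_inl, nfsdWeight_completeBipartiteGraph_inr]
  simp only [hV', hlr, hrl]

theorem hasNFSD_two_completeBipartiteGraph (n : ℕ) (hn : 2 ≤ n) :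
    HasNFSD (completeBipartiteGraph (Fin n) (Fin n)) 2 := by
  refine ⟨Sum.elim (fun _ => 1) (fun _ => 2), fun _ => 1, ?_, by simp, ?_⟩
  · rintro (v | v) <;> simp
  · rintro (x | x) (y | y) hxy
    · simp at hxy
    · rw [nfsdWeight_completeBipartiteGraph_inl, nfsdWeight_completeBipartiteGraph_inr]
      simp
      omega
    · rw [nfsdWeight_completeBipartiteGraph_inl, nfsdWeight_completeBipartiteGraph_inr]
      simp
      omega
    · simp at hxy

theorem stmt_10 (n : ℕ) (hn : 2 ≤ n) :
    fgndi (completeBipartiteGraph (Fin n) (Fin n)) = 2 ∧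
      HasNFSD (completeBipartiteGraph (Fin n) (Fin n)) 2 ∧
      ¬ HasNFSD (completeBipartiteGraph (Fin n) (Fin n)) 1 := by
  have h2 := hasNFSD_two_completeBipartiteGraph n hn
  have h1 := not_hasNFSD_one_completeBipartiteGraph n (by omega)
  refine ⟨le_antisymm (Nat.sInf_le h2) (le_csInf ⟨2, h2⟩ fun k hk => ?_), h2, h1⟩
  have : Nonempty (Fin n ⊕ Fin n) := ⟨Sum.inl ⟨0, by omega⟩⟩
  by_contra! hlt
  interval_cases k
  · exact not_hasNFSD_zero _ hk
  · exact h1 hk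
end

section
/- Let r ≥ 2 and t ≥ 1 be integers and let K_{t,t,...,t} be the balanced complete r-partite graph in which all r part sizes equal t. If r ≥ 3 or t ≥ 2 (so the graph is not K_2), then fgndi_Σ(K_{t,...,t}) ≤ 3; that is, the balanced complete r-partite graph admits an NFSD total 3-coloring. -/
open SimpleGraph Finset

/-- A total coloring that depends only on the parts: vertices of part `i` get `a i`, edges
between parts `i` and `j` get `g i j`. It is an NFSD total 3-coloring as soon as the resulting
weights of the parts are distinct. -/
theorem hasNFSD_of_parts {r t : ℕ} (a : Fin r → ℕ) (g : Fin r → Fin r → ℕ)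
    (hsymm : ∀ i j, g i j = g j i) (ha : ∀ i, a i ∈ Finset.Icc 1 3)
    (hg : ∀ i j, g i j ∈ Finset.Icc 1 3)
    (hne : ∀ i j, i ≠ j →
      a i + t * ∑ l, (if i ≠ l then g i l + a l else 0) ≠
        a j + t * ∑ l, (if j ≠ l then g j l + a l else 0)) :
    HasNFSD (completeMultipartiteGraph (fun _ : Fin r => Fin t)) 3 := by
  classical
  let fE : Sym2 (Σ _ : Fin r, Fin t) → ℕ :=
    Sym2.lift ⟨fun x y => g x.1 y.1, fun x y => hsymm x.1 y.1⟩
  have hw : ∀ x, nfsdWeight (completeMultipartiteGraph (fun _ : Fin r => Fin t))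
      (fun v => a v.1) fE x =
        a x.1 + t * ∑ l, (if x.1 ≠ l then g x.1 l + a l else 0) := by
    intro x
    unfold nfsdWeight
    rw [Finset.sum_filter, Fintype.sum_sigma, Finset.mul_sum]
    congr 1
    refine Finset.sum_congr rfl fun l _ => ?_
    simp [fE, completeMultipartiteGraph]
  refine ⟨fun v => a v.1, fE, fun v => ha v.1, fun e _ => ?_, fun x y hxy => ?_⟩
  · induction e with
    | _ x y => exact hg x.1 y.1
  · rw [hw, hw]
    exact hne _ _ hxy

/-- The number of `j < r` with `r ≤ i + j` is `i`. -/
theorem sum_ite_le_add (r i : ℕ) (hi : i ≤ r) :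
    ∑ j : Fin r, (if r ≤ i + j then 1 else 0) = i := by
  rw [Fin.sum_univ_eq_sum_range (fun j => if r ≤ i + j then 1 else 0) r,
    ← Finset.card_filter]
  have : (Finset.range r).filter (fun j => r ≤ i + j) = Finset.Ico (r - i) r := by
    ext j
    simp only [Finset.mem_filter, Finset.mem_range, Finset.mem_Ico]
    omega
  rw [this, Nat.card_Ico]
  omega

/-- An edge weighting of the complete graph on `{0, …, r - 1}` by `{1, 2, 3}`: a threshold
weighting, perturbed on the edge joining `0` and `⌈r / 2⌉`. -/
def irregularWeight (r i j : ℕ) : ℕ :=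
  1 + 2 * (if r ≤ i + j then 1 else 0) + (if i = 0 ∧ j = (r + 1) / 2 then 1 else 0) +
    (if i = (r + 1) / 2 ∧ j = 0 then 1 else 0)

theorem irregularWeight_comm (r i j : ℕ) : irregularWeight r i j = irregularWeight r j i := by
  unfold irregularWeight
  split_ifs <;> omega

theorem irregularWeight_mem (r i j : ℕ) (hr : 3 ≤ r) :
    irregularWeight r i j ∈ Finset.Icc 1 3 := by
  rw [Finset.mem_Icc]
  unfold irregularWeight
  split_ifs <;> omega

theorem irregularWeight_self (r i : ℕ) (hr : 3 ≤ r) :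
    irregularWeight r i i = 1 + 2 * (if r ≤ 2 * i then 1 else 0) := by
  unfold irregularWeight
  split_ifs <;> omega

theorem sum_irregularWeight (r : ℕ) (hr : 3 ≤ r) (i : Fin r) :
    ∑ j : Fin r, irregularWeight r i j =
      r + 2 * i + (if (i : ℕ) = 0 then 1 else 0) + (if (i : ℕ) = (r + 1) / 2 then 1 else 0) := by
  have point : ∀ (p : Prop) [Decidable p] (m : ℕ), m < r →
      ∑ j : Fin r, (if p ∧ (j : ℕ) = m then 1 else 0) = if p then 1 else 0 := by
    intro p _ m hm
    rw [Fin.sum_univ_eq_sum_range (fun j => if p ∧ j = m then 1 else 0) r]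
    by_cases hp : p <;> simp [hp, hm]
  unfold irregularWeight
  rw [Finset.sum_add_distrib, Finset.sum_add_distrib, Finset.sum_add_distrib, ← Finset.mul_sum,
    sum_ite_le_add r i i.2.le, point _ _ (by omega), point _ _ (by omega)]
  simp

theorem sum_irregularWeight_ne (r : ℕ) (hr : 3 ≤ r) (i j : Fin r) (hij : i ≠ j) :
    ∑ l, (if i ≠ l then irregularWeight r i l + 1 else 0) ≠
      ∑ l, (if j ≠ l then irregularWeight r j l + 1 else 0) := by
  have key : ∀ i : Fin r, ∑ l, (if i ≠ l then irregularWeight r i l + 1 else 0) +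
      (irregularWeight r i i + 1) = ∑ l : Fin r, irregularWeight r i l + r := by
    intro i
    have hsplit : ∑ l : Fin r, irregularWeight r i l + r =
        ∑ l : Fin r, (irregularWeight r i l + 1) := by
      simp [Finset.sum_add_distrib]
    rw [hsplit, ← Finset.sum_filter, Finset.filter_ne, Finset.sum_erase_add _ _ (mem_univ i)]
  have hi := key i
  have hj := key j
  rw [sum_irregularWeight r hr, irregularWeight_self r _ hr] at hi hj
  have hij' : (i : ℕ) ≠ j := fun h => hij (Fin.ext h)
  intro heq
  rw [heq] at hi
  clear heq key
  generalize ∑ l : Fin r, (if j ≠ l then irregularWeight r j l + 1 else 0) = B at hi hj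
  generalize (i : ℕ) = m at *
  generalize (j : ℕ) = n at *
  split_ifs at hi hj <;> omega

theorem hasNFSD_three (r t : ℕ) (hr : 2 ≤ r) (ht : 1 ≤ t) (h : 3 ≤ r ∨ 2 ≤ t) :
    HasNFSD (completeMultipartiteGraph (fun _ : Fin r => Fin t)) 3 := by
  by_cases hr3 : 3 ≤ r
  · refine hasNFSD_of_parts (fun _ => 1) (fun i j => irregularWeight r i j)
      (fun i j => irregularWeight_comm r i j) (fun _ => by simp)
      (fun i j => irregularWeight_mem r i j hr3) fun i j hij heq => ?_
    exact sum_irregularWeight_ne r hr3 i j hij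
      (Nat.eq_of_mul_eq_mul_left ht (Nat.add_left_cancel heq))
  · obtain rfl : r = 2 := by omega
    refine hasNFSD_of_parts (fun i => i + 1) (fun _ _ => 1) (fun _ _ => rfl) ?_
      (fun _ _ => by simp) ?_
    · intro i
      rw [Finset.mem_Icc]
      omega
    · intro i j hij
      fin_cases i <;> fin_cases j <;> simp [Fin.sum_univ_two] at hij ⊢ <;> omega

theorem stmt_13 (r t : ℕ) (hr : 2 ≤ r) (ht : 1 ≤ t) (h : 3 ≤ r ∨ 2 ≤ t) :
    fgndi (completeMultipartiteGraph (fun _ : Fin r => Fin t)) ≤ 3 ∧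
      HasNFSD (completeMultipartiteGraph (fun _ : Fin r => Fin t)) 3 := by
  have h3 := hasNFSD_three r t hr ht h
  exact ⟨Nat.sInf_le h3, h3⟩
end

section
/- Every tree T with at least three vertices satisfies fgndi_Σ(T) ≤ 2; that is, T admits an NFSD total 2-coloring. -/
open SimpleGraph Finset

open scoped Classical in
/-- In a connected graph, edge labels in `ZMod 2` can realise any prescribed vertex sums away from
one given vertex `r`. -/
theorem exists_edge_labels {V : Type*} [Fintype V] {G : SimpleGraph V} (hG : G.Connected)
    (r : V) (t : V → ZMod 2) :
    ∃ b : Sym2 V → ZMod 2, ∀ z, z ≠ r →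
      ∑ y ∈ univ.filter (fun y => G.Adj z y), b s(z, y) = t z := by
  have single (x : V) : ∃ b : Sym2 V → ZMod 2, ∀ z, z ≠ r →
      ∑ y ∈ univ.filter (fun y => G.Adj z y), b s(z, y) = if z = x then 1 else 0 := by
    have hx := (reachable_iff_reflTransGen r x).1 (hG.preconnected r x)
    induction hx with
    | refl => exact ⟨0, fun z hz => by simp [hz]⟩
    | @tail u v _ huv ih =>
      obtain ⟨b, hb⟩ := ih
      refine ⟨fun e => b e + if e = s(u, v) then 1 else 0, fun z hz => ?_⟩
      rw [sum_add_distrib, hb z hz]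
      have hne := huv.ne
      by_cases hzu : z = u
      · subst hzu
        have : ∀ y, (s(z, y) = s(z, v)) ↔ y = v := by simp
        simp only [this, sum_ite_eq', mem_filter, mem_univ, true_and, huv, hne, if_true, if_false]
        decide
      · by_cases hzv : z = v
        · subst hzv
          have : ∀ y, (s(z, y) = s(u, z)) ↔ y = u := by
            intro y
            rw [Sym2.eq_swap (a := u)]
            simp [hzu]
          simp only [this, sum_ite_eq', mem_filter, mem_univ, true_and, huv.symm, hzu, if_true,
            if_false, zero_add]
        · have : ∀ y, s(z, y) ≠ s(u, v) := by simp [hzu, hzv]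
          simp [this, hzu, hzv]
  choose b hb using single
  refine ⟨fun e => ∑ x, t x * b x e, fun z hz => ?_⟩
  rw [sum_comm]
  simp only [← mul_sum, hb _ z hz]
  simp

open scoped Classical in
/-- In a connected graph with at least three vertices, the neighbor of a leaf has another
neighbor. -/
theorem exists_adj_ne_of_leaf {V : Type*} [Fintype V] {G : SimpleGraph V} (hG : G.Connected)
    (hcard : 3 ≤ Fintype.card V) {r p : V} (hr : ∀ y, G.Adj r y ↔ y = p) :
    ∃ z, G.Adj p z ∧ z ≠ r := by
  by_contra! h
  have hall (x : V) : x ∈ ({r, p} : Finset V) := by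
    have hx := (reachable_iff_reflTransGen r x).1 (hG.preconnected r x)
    induction hx with
    | refl => simp
    | @tail u v _ huv ih =>
      simp only [mem_insert, mem_singleton] at ih ⊢
      rcases ih with rfl | rfl
      · exact .inr ((hr v).1 huv)
      · exact .inl (h v huv)
  have : Fintype.card V ≤ ({r, p} : Finset V).card :=
    card_le_card fun x _ => hall x
  have := card_le_two (a := r) (b := p)
  omega

open scoped Classical in
/-- With positive colors, a leaf weighs less than its neighbor. -/
theorem nfsdWeight_leaf_lt {V : Type*} [Fintype V] {G : SimpleGraph V} (hG : G.Connected)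
    (hcard : 3 ≤ Fintype.card V) {r p : V} (hr : ∀ y, G.Adj r y ↔ y = p)
    (fV : V → ℕ) (fE : Sym2 V → ℕ) (hpos : ∀ v, 0 < fV v) :
    nfsdWeight G fV fE r < nfsdWeight G fV fE p := by
  obtain ⟨z, hpz, hzr⟩ := exists_adj_ne_of_leaf hG hcard hr
  have hpr : G.Adj p r := ((hr p).2 rfl).symm
  have hsub : ({r, z} : Finset V) ⊆ univ.filter (fun y => G.Adj p y) := by
    intro y hy
    simp only [mem_insert, mem_singleton] at hy
    rcases hy with rfl | rfl <;> simp [hpr, hpz]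
  have hle := sum_le_sum_of_subset (f := fun y => fE s(p, y) + fV y) hsub
  rw [sum_pair hzr.symm, Sym2.eq_swap] at hle
  have hz := hpos z
  have hN : univ.filter (fun y => G.Adj r y) = {p} := by ext y; simp [hr]
  simp only [nfsdWeight, hN, sum_singleton]
  omega

open scoped Classical in
theorem hasNFSD_two_of_isTree {V : Type*} [Fintype V] {T : SimpleGraph V}
    (htree : T.IsTree) (hcard : 3 ≤ Fintype.card V) : HasNFSD T 2 := by
  have hconn := htree.connected
  have : Nontrivial V := Fintype.one_lt_card_iff_nontrivial.1 (by omega)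
  obtain ⟨r, hdeg⟩ := htree.exists_vert_degree_one_of_nontrivial
  obtain ⟨p, hp⟩ := degree_eq_one_iff_existsUnique_adj.1 hdeg
  have hr (y : V) : T.Adj r y ↔ y = p := ⟨hp.2 y, fun h => h ▸ hp.1⟩
  obtain ⟨c⟩ : Nonempty (T.Coloring (ZMod 2)) := htree.isAcyclic.isBipartite
  obtain ⟨b, hb⟩ := exists_edge_labels hconn r
    fun x => c x - 1 - ∑ y ∈ univ.filter (fun y => T.Adj x y), 1
  let fE (e : Sym2 V) : ℕ := if b e = 0 then 2 else 1
  have hfE (e : Sym2 V) : (fE e : ZMod 2) = b e := by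
    simp only [fE]
    generalize b e = a
    revert a
    decide
  have hw (x : V) (hx : x ≠ r) : (nfsdWeight T (fun _ => 1) fE x : ZMod 2) = c x := by
    simp only [nfsdWeight, Nat.cast_add, Nat.cast_one, Nat.cast_sum, hfE, sum_add_distrib, hb x hx]
    ring
  have hlt := nfsdWeight_leaf_lt hconn hcard hr (fun _ => 1) fE fun _ => one_pos
  refine ⟨fun _ => 1, fE, by simp, fun e _ => ?_, fun x y hxy h => ?_⟩
  · simp only [fE]
    split_ifs <;> simp
  · by_cases hx : x = r
    · subst hx
      obtain rfl := (hr y).1 hxy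
      exact hlt.ne h
    by_cases hy : y = r
    · subst hy
      obtain rfl := (hr x).1 hxy.symm
      exact hlt.ne' h
    exact c.valid hxy (by rw [← hw x hx, ← hw y hy, h])

theorem stmt_15 {V : Type*} [Fintype V] (T : SimpleGraph V)
    (htree : T.IsTree) (hcard : 3 ≤ Fintype.card V) :
    fgndi T ≤ 2 ∧ HasNFSD T 2 := by
  have h := hasNFSD_two_of_isTree htree hcard
  exact ⟨Nat.sInf_le h, h⟩
end

section
/- Every connected bipartite simple graph G with at least three vertices satisfies fgndi_Σ(G) ≤ 3; that is, G admits an NFSD total 3-coloring. -/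
open SimpleGraph Finset

open scoped Classical in
/-- The linear map sending an edge labelling to the sums of its labels around each vertex. -/
noncomputable def incidentSum {V : Type*} [Fintype V] (G : SimpleGraph V) (R : Type*) [CommRing R] :
    (Sym2 V → R) →ₗ[R] (V → R) where
  toFun w x := ∑ y ∈ univ.filter (fun y => G.Adj x y), w s(x, y)
  map_add' w w' := by
    funext x
    simp [Finset.sum_add_distrib]
  map_smul' r w := by
    funext x
    simp [Finset.mul_sum]

open scoped Classical in
theorem incidentSum_single {V : Type*} [Fintype V] (G : SimpleGraph V) {R : Type*} [CommRing R]
    {u v : V} (h : G.Adj u v) (r : R) :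
    incidentSum G R (Pi.single s(u, v) r) = Pi.single u r + Pi.single v r := by
  funext x
  have huv := h.ne
  simp only [incidentSum, LinearMap.coe_mk, AddHom.coe_mk, Pi.add_apply, Pi.single_apply,
    Sym2.eq_iff]
  by_cases hu : x = u
  · subst hu
    rw [Finset.sum_eq_single v] <;> simp_all
  · by_cases hv : x = v
    · subst hv
      rw [Finset.sum_eq_single u] <;> simp_all [h.symm]
    · simp [hu, hv]

open scoped Classical in
/-- Along a walk in a graph with a sign function alternating on edges, the difference of the signed
indicators of the endpoints is realised by an edge labelling. -/
theorem signed_single_sub_mem_range {V : Type*} [Fintype V] {G : SimpleGraph V} {R : Type*}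
    [CommRing R] {ε : V → R} (hε : ∀ u v, G.Adj u v → ε v = -ε u) {u v : V} (p : G.Walk u v) :
    (Pi.single u (ε u) - Pi.single v (ε v) : V → R) ∈ LinearMap.range (incidentSum G R) := by
  induction p with
  | nil => simp
  | @cons u v w h p ih =>
    have key : (Pi.single u (ε u) - Pi.single v (ε v) : V → R) ∈
        LinearMap.range (incidentSum G R) :=
      ⟨Pi.single s(u, v) (ε u), by
        rw [incidentSum_single G h, hε u v h, Pi.single_neg, sub_neg_eq_add]⟩
    simpa using add_mem key ih

/-- In a connected graph with an alternating sign function, every vertex function of signed sum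
zero is realised by an edge labelling. -/
theorem exists_incidentSum_eq {V : Type*} [Fintype V] {G : SimpleGraph V} (hG : G.Connected)
    {R : Type*} [CommRing R] {ε : V → R} (hε : ∀ u v, G.Adj u v → ε v = -ε u)
    (hsq : ∀ v, ε v * ε v = 1) {s : V → R} (hs : ∑ v, ε v * s v = 0) :
    ∃ w, incidentSum G R w = s := by
  classical
  obtain ⟨r⟩ := hG.nonempty
  have hmem : ∑ v, (s v * ε v) • (Pi.single v (ε v) - Pi.single r (ε r) : V → R) ∈
      LinearMap.range (incidentSum G R) :=
    sum_mem fun v _ => Submodule.smul_mem _ _ <|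
      signed_single_sub_mem_range hε (hG.preconnected v r).some
  have heq : ∑ v, (s v * ε v) • (Pi.single v (ε v) - Pi.single r (ε r) : V → R) = s := by
    simp only [smul_sub, Finset.sum_sub_distrib, ← Finset.sum_smul]
    rw [show ∑ v, s v * ε v = 0 by simpa only [mul_comm] using hs, zero_smul, sub_zero]
    funext x
    simp [Finset.sum_apply, Pi.single_apply, mul_assoc, hsq]
  rwa [heq] at hmem

/-- A bipartite graph on at least three vertices has a labelling by `ZMod 3`, proper on
edges, with equal sums over the two classes (the sign `ε` tells the classes apart). -/
theorem exists_signs_and_balanced_labelling {V : Type*} [Fintype V] {G : SimpleGraph V}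
    (hcard : 3 ≤ Fintype.card V) (hbip : G.Colorable 2) :
    ∃ ε t : V → ZMod 3, (∀ u v, G.Adj u v → ε v = -ε u) ∧ (∀ v, ε v * ε v = 1) ∧
      ∑ v, ε v * t v = 0 ∧ ∀ u v, G.Adj u v → t u ≠ t v := by
  classical
  obtain ⟨c⟩ := hbip
  obtain ⟨a, b, hab, hc⟩ :=
    Fintype.exists_ne_map_eq_of_card_lt c (by simpa using Nat.lt_of_succ_le hcard)
  have hside : ∀ u v, G.Adj u v → (c u = c a ↔ c v ≠ c a) := fun u v h => by
    have := c.valid h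
    omega
  let ε : V → ZMod 3 := fun v => if c v = c a then 1 else -1
  let base : V → ZMod 3 := fun v => if c v = c a then 0 else 2
  obtain ⟨p, q, hp, hq, hpq⟩ : ∃ p q : ZMod 3, p ≠ 2 ∧ q ≠ 2 ∧
      (∑ v, ε v * base v) + (p + q) = 0 := by
    generalize ∑ v, ε v * base v = K
    revert K
    decide
  let t : V → ZMod 3 := fun v => base v + (if v = a then p else 0) + (if v = b then q else 0)
  have ht_same : ∀ v, c v = c a → t v ≠ 2 := fun v hv => by
    by_cases ha : v = a
    · subst ha
      simpa [t, base, hab] using hp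
    · by_cases hb : v = b
      · subst hb
        simpa [t, base, hc, ha] using hq
      · simp only [t, base, hv, ha, hb, if_true, if_false]
        decide
  have ht_other : ∀ v, c v ≠ c a → t v = 2 := fun v hv => by
    have ha : v ≠ a := fun h => hv (h ▸ rfl)
    have hb : v ≠ b := fun h => hv (h ▸ hc.symm)
    simp [t, base, hv, ha, hb]
  refine ⟨ε, t, fun u v h => ?_, fun v => ?_, ?_, fun u v h => ?_⟩
  · have := hside u v h
    by_cases hu : c u = c a <;> by_cases hv : c v = c a <;> simp_all [ε]
  · by_cases hv : c v = c a <;> simp [ε, hv]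
  · simp only [t, mul_add, Finset.sum_add_distrib, mul_ite, mul_zero, Finset.sum_ite_eq',
      Finset.mem_univ, if_true]
    simpa [ε, hc, add_assoc] using hpq
  · by_cases hu : c u = c a
    · rw [ht_other v ((hside u v h).1 hu)]
      exact ht_same u hu
    · have hv : c v = c a := by
        by_contra hv
        exact hu ((hside u v h).2 hv)
      rw [ht_other u hu]
      exact (ht_same v hv).symm

theorem hasNFSD_three_s17 {V : Type*} [Fintype V] (G : SimpleGraph V)
    (hconn : G.Connected) (hcard : 3 ≤ Fintype.card V) (hbip : G.Colorable 2) :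
    HasNFSD G 3 := by
  classical
  obtain ⟨ε, t, hε, hsq, hsum, ht⟩ := exists_signs_and_balanced_labelling hcard hbip
  obtain ⟨w, hw⟩ := exists_incidentSum_eq hconn hε hsq hsum
  have hlift : ∀ z : ZMod 3, ∃ n : ℕ, n ∈ Finset.Icc 1 3 ∧ (n : ZMod 3) = z := fun z => by
    fin_cases z
    exacts [⟨3, by simp, rfl⟩, ⟨1, by simp, rfl⟩, ⟨2, by simp, rfl⟩]
  choose lift hmem hcast using hlift
  have hthree : ((3 : ℕ) : ZMod 3) = 0 := by decide
  have hweight : ∀ x, (nfsdWeight G (fun _ => 3) (fun e => lift (w e)) x : ZMod 3) = t x :=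
    fun x => by
      rw [← hw]
      simp only [nfsdWeight, incidentSum, LinearMap.coe_mk, AddHom.coe_mk, Nat.cast_add,
        Nat.cast_sum, hcast, hthree, zero_add, add_zero]
  refine ⟨fun _ => 3, fun e => lift (w e), fun _ => by simp, fun e _ => hmem _,
    fun x y h heq => ht x y h ?_⟩
  rw [← hweight x, ← hweight y, heq]

theorem stmt_17 {V : Type*} [Fintype V] (G : SimpleGraph V)
    (hconn : G.Connected) (hcard : 3 ≤ Fintype.card V)
    (hbip : G.Colorable 2) :
    fgndi G ≤ 3 ∧ HasNFSD G 3 :=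
  have h := hasNFSD_three_s17 G hconn hcard hbip
  ⟨Nat.sInf_le h, h⟩
end

section
/- Let G be a connected bipartite simple graph with at least three vertices and bipartition classes X and Y such that every vertex of X has even degree. Then fgndi_Σ(G) ≤ 2; that is, G admits an NFSD total 2-coloring. -/
open SimpleGraph Finset

open scoped Classical in
/-- A single edge has boundary equal to the sum of its endpoints. -/
lemma sum_adj_single_edge {V : Type*} [Fintype V] {G : SimpleGraph V} {u w : V}
    (h : G.Adj u w) (x : V) :
    ∑ y ∈ univ.filter (fun y => G.Adj x y), (Pi.single s(u, w) 1 : Sym2 V → ZMod 2) s(x, y) =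
      (Pi.single u 1 : V → ZMod 2) x + (Pi.single w 1 : V → ZMod 2) x := by
  have hne := h.ne
  simp only [Pi.single_apply, Sym2.eq_iff]
  by_cases hu : x = u
  · subst hu
    simp [hne, Finset.sum_ite_eq', h]
  · by_cases hw : x = w
    · subst hw
      simp [hu, Finset.sum_ite_eq', h.symm]
    · simp [hu, hw]

open scoped Classical in
lemma exists_edge_boundary_pair {V : Type*} [Fintype V] {G : SimpleGraph V} {u v : V}
    (p : G.Walk u v) :
    ∃ e : Sym2 V → ZMod 2, ∀ x, ∑ y ∈ univ.filter (fun y => G.Adj x y), e s(x, y) =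
      (Pi.single u 1 : V → ZMod 2) x + (Pi.single v 1 : V → ZMod 2) x := by
  induction p with
  | nil => exact ⟨0, fun x => by simp [CharTwo.add_self_eq_zero]⟩
  | @cons a b c h _ ih =>
    obtain ⟨e, he⟩ := ih
    refine ⟨Pi.single s(a, b) 1 + e, fun x => ?_⟩
    simp only [Pi.add_apply, sum_add_distrib, he, sum_adj_single_edge h]
    linear_combination CharTwo.add_self_eq_zero ((Pi.single b 1 : V → ZMod 2) x)

open scoped Classical in
/-- In a connected graph every function of total sum zero modulo two is the boundary of a
`ZMod 2`-valued edge labelling. -/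
lemma SimpleGraph.Connected.exists_edge_boundary {V : Type*} [Fintype V] {G : SimpleGraph V}
    (hG : G.Connected) (t : V → ZMod 2) (ht : ∑ v, t v = 0) :
    ∃ e : Sym2 V → ZMod 2, ∀ x, ∑ y ∈ univ.filter (fun y => G.Adj x y), e s(x, y) = t x := by
  obtain ⟨r⟩ := hG.nonempty
  choose e he using fun v => exists_edge_boundary_pair (hG.preconnected v r).some
  refine ⟨fun s => ∑ v, t v * e v s, fun x => ?_⟩
  rw [sum_comm]
  simp only [← mul_sum, he, mul_add, sum_add_distrib, ← sum_mul, ht]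
  simp [Pi.single_apply]

/-- The color in `{1, 2}` of a given parity. -/
def parityColor (z : ZMod 2) : ℕ := if z = 0 then 2 else 1

lemma parityColor_mem (z : ZMod 2) : parityColor z ∈ Finset.Icc 1 2 := by
  unfold parityColor
  split_ifs <;> simp

lemma cast_parityColor (z : ZMod 2) : (parityColor z : ZMod 2) = z := by
  revert z
  decide

open scoped Classical in
lemma hasNFSD_two_of_even_side {V : Type*} [Fintype V] (G : SimpleGraph V)
    (hG : G.Connected) (X : Set V) (hX : X.Nonempty)
    (hbip : ∀ u v, G.Adj u v → (u ∈ X ↔ v ∉ X)) (heven : ∀ x ∈ X, Even (G.degree x)) :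
    HasNFSD G 2 := by
  obtain ⟨a, ha⟩ := hX
  let τ : V → ZMod 2 := fun v => if v ∈ X then 1 else 0
  let g : V → ZMod 2 := Pi.single a (∑ v, τ v)
  have hdeg : ∑ v, ∑ y ∈ univ.filter (fun y => G.Adj v y), g y = 0 := by
    simp only [sum_filter]
    rw [sum_comm]
    have hrow (y : V) : ∑ x, (if G.Adj x y then g y else 0) = (G.degree y : ZMod 2) * g y := by
      rw [← sum_filter, sum_const, nsmul_eq_mul, ← G.card_neighborFinset_eq_degree,
        G.neighborFinset_eq_filter]
      simp only [G.adj_comm]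
    refine sum_eq_zero fun y _ => ?_
    rw [hrow]
    by_cases hy : y = a
    · subst hy
      rw [(ZMod.natCast_eq_zero_iff_even).2 (heven y ha), zero_mul]
    · simp [g, hy]
  obtain ⟨e, he⟩ := hG.exists_edge_boundary
    (fun v => τ v - g v - ∑ y ∈ univ.filter (fun y => G.Adj v y), g y) (by
      rw [sum_sub_distrib, sum_sub_distrib, hdeg]
      simp [g])
  have hw (x : V) : (nfsdWeight G (parityColor ∘ g) (parityColor ∘ e) x : ZMod 2) = τ x := by
    simp only [nfsdWeight, Function.comp_apply, Nat.cast_add, Nat.cast_sum, cast_parityColor,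
      sum_add_distrib, he]
    ring
  refine ⟨parityColor ∘ g, parityColor ∘ e, fun v => parityColor_mem _,
    fun s _ => parityColor_mem _, fun x y hxy h => ?_⟩
  have hτ : τ x = τ y := by rw [← hw, ← hw, h]
  have := hbip x y hxy
  by_cases hy : y ∈ X <;> simp_all [τ]

theorem stmt_18 {V : Type*} [Fintype V] (G : SimpleGraph V) [DecidableRel G.Adj]
    (hconn : G.Connected) (hcard : 3 ≤ Fintype.card V)
    (X Y : Set V) (hdisj : Disjoint X Y) (hcover : X ∪ Y = Set.univ)
    (hbip : ∀ u v : V, G.Adj u v → ((u ∈ X ∧ v ∈ Y) ∨ (u ∈ Y ∧ v ∈ X)))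
    (heven : ∀ x ∈ X, Even (G.degree x)) :
    fgndi G ≤ 2 ∧ HasNFSD G 2 := by
  have hXY (v : V) : v ∈ Y ↔ v ∉ X :=
    ⟨fun hY hX => Set.disjoint_left.1 hdisj hX hY,
      fun hX => ((hcover ▸ Set.mem_univ v : v ∈ X ∪ Y)).resolve_left hX⟩
  have : Nontrivial V := Fintype.one_lt_card_iff_nontrivial.1 (by omega)
  obtain ⟨u⟩ := hconn.nonempty
  obtain ⟨v, huv⟩ := hconn.preconnected.exists_adj_of_nontrivial u
  have hX : X.Nonempty := (hbip u v huv).elim (fun h => ⟨u, h.1⟩) (fun h => ⟨v, h.2⟩)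
  have h2 : HasNFSD G 2 := hasNFSD_two_of_even_side G hconn X hX
    (fun x y hxy => by have := hbip x y hxy; simp only [hXY] at this; tauto)
    (fun x hx => by convert heven x hx)
  exact ⟨Nat.sInf_le h2, h2⟩
end

section
/- Let G be a connected bipartite simple graph with at least three vertices and maximum degree Δ(G) = 3. Then fgndi_Σ(G) ≤ 2; that is, G admits an NFSD total 2-coloring. -/
open SimpleGraph Finset

/-- In a graph, any two vertices joined by a walk bound an edge set modulo `2`. -/
theorem exists_edge_chain_of_reachable {V : Type*} [Fintype V] [DecidableEq V]
    (H : SimpleGraph V) {a b : V} (h : H.Reachable a b) :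
    ∃ f : Sym2 V → ZMod 2, (∀ e ∉ H.edgeSet, f e = 0) ∧
      ∀ x, ∑ y, f s(x, y) = (if x = a then 1 else 0) + (if x = b then 1 else 0) := by
  obtain ⟨w⟩ := h
  induction w with
  | nil => exact ⟨0, fun _ _ => rfl, fun x => by simp [CharTwo.add_self_eq_zero]⟩
  | @cons a c b hac _ ih =>
    obtain ⟨f, hf, hs⟩ := ih
    refine ⟨fun e => f e + if e = s(a, c) then 1 else 0, fun e he => ?_, fun x => ?_⟩
    · have : e ≠ s(a, c) := by rintro rfl; exact he hac
      simp [hf e he, this]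
    · have hne : a ≠ c := hac.ne
      have key : ∑ y, (if s(x, y) = s(a, c) then (1 : ZMod 2) else 0) =
          (if x = a then 1 else 0) + (if x = c then 1 else 0) := by
        by_cases h1 : x = a
        · subst h1
          simp [hne]
        · by_cases h2 : x = c
          · subst h2
            simp [h1]
          · simp [h1, h2]
      have h2 : (2 : ZMod 2) = 0 := rfl
      rw [sum_add_distrib, hs, key]
      linear_combination (if x = c then (1 : ZMod 2) else 0) * h2

/-- A vertex demand modulo `2` with zero total, supported on one component, is met by some
edge set. -/
theorem exists_edge_chain {V : Type*} [Fintype V] [DecidableEq V]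
    (H : SimpleGraph V) (r : V) (t : V → ZMod 2)
    (hr : ∀ x, t x ≠ 0 → H.Reachable r x) (ht : ∑ x, t x = 0) :
    ∃ f : Sym2 V → ZMod 2, (∀ e ∉ H.edgeSet, f e = 0) ∧ ∀ x, ∑ y, f s(x, y) = t x := by
  have hp (z : V) : ∃ f : Sym2 V → ZMod 2, (∀ e ∉ H.edgeSet, f e = 0) ∧
      ∀ x, ∑ y, f s(x, y) = t z * ((if x = r then 1 else 0) + (if x = z then 1 else 0)) := by
    by_cases hz : t z = 0
    · exact ⟨0, fun _ _ => rfl, fun x => by simp [hz]⟩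
    · obtain ⟨f, hf, hs⟩ := exists_edge_chain_of_reachable H (hr z hz)
      refine ⟨fun e => t z * f e, fun e he => by simp [hf e he], fun x => ?_⟩
      rw [← mul_sum, hs]
  choose f hf hs using hp
  refine ⟨fun e => ∑ z, f z e, fun e he => sum_eq_zero fun z _ => hf z e he, fun x => ?_⟩
  rw [sum_comm]
  simp [hs, mul_add, sum_add_distrib, ht]

theorem nfsdWeight_eq_sum_neighborFinset {V : Type*} [Fintype V] (G : SimpleGraph V)
    [DecidableRel G.Adj] (fV : V → ℕ) (fE : Sym2 V → ℕ) (x : V) :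
    nfsdWeight G fV fE x = fV x + ∑ y ∈ G.neighborFinset x, (fE s(x, y) + fV y) := by
  rw [nfsdWeight, G.neighborFinset_eq_filter]
  congr!

/-- Vertex colors can be completed by edge colors in `{1, 2}`, equal to `2` outside `H`, to reach
prescribed weight parities. -/
theorem exists_edge_coloring_weight_parity {V : Type*} [Fintype V] [DecidableEq V]
    (G H : SimpleGraph V) [DecidableRel G.Adj] (hHG : H ≤ G) (r : V) (fV : V → ℕ) (p : V → ZMod 2)
    (hr : ∀ x, p x - (fV x + ∑ y ∈ G.neighborFinset x, (fV y : ZMod 2)) ≠ 0 → H.Reachable r x)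
    (hp : ∑ x, p x = ∑ x, (fV x : ZMod 2) * (1 + G.degree x)) :
    ∃ fE : Sym2 V → ℕ, (∀ e, fE e ∈ Icc 1 2) ∧ (∀ e ∉ H.edgeSet, fE e = 2) ∧
      ∀ x, (nfsdWeight G fV fE x : ZMod 2) = p x := by
  obtain ⟨f, hf, hs⟩ := exists_edge_chain H r _ hr (by
    rw [sum_sub_distrib, hp, sum_add_distrib, sub_eq_zero]
    have : ∑ x, ∑ y ∈ G.neighborFinset x, (fV y : ZMod 2) = ∑ x, fV x * (G.degree x : ZMod 2) := by
      rw [sum_comm' (t' := univ) (s' := fun y => G.neighborFinset y) (by simp [G.adj_comm])]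
      simp [mul_comm]
    rw [this, ← sum_add_distrib]
    exact sum_congr rfl fun x _ => by ring)
  refine ⟨fun e => if f e = 0 then 2 else 1, fun e => ?_, fun e he => by simp [hf e he],
    fun x => ?_⟩
  · dsimp only
    split_ifs <;> simp
  have hcast (a : ZMod 2) : ((if a = 0 then 2 else 1 : ℕ) : ZMod 2) = a := by
    revert a; decide
  have hE : ∑ y ∈ G.neighborFinset x, f s(x, y) = ∑ y, f s(x, y) :=
    sum_subset (subset_univ _) fun y _ hy => hf _ fun h => hy (by simpa using hHG h)
  rw [nfsdWeight_eq_sum_neighborFinset, sum_add_distrib, Nat.cast_add, Nat.cast_add, Nat.cast_sum,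
    Nat.cast_sum, sum_congr rfl fun y _ => hcast (f s(x, y)), hE, hs]
  ring

/-- A subcubic bipartite graph in which all degrees are odd and which has a suitable non-cut
vertex `u` is NFSD `2`-colorable when a color class is odd. -/
theorem hasNFSD_two_of_odd_degrees {V : Type*} [Fintype V] [DecidableEq V] (G : SimpleGraph V)
    [DecidableRel G.Adj] (hcard : 3 ≤ Fintype.card V) (c : V → ZMod 2)
    (hc : ∀ x y, G.Adj x y → c x ≠ c y) (hc1 : ∑ x, c x = 1)
    (hdeg : ∀ x, G.degree x = 1 ∨ G.degree x = 3) (u : V)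
    (hu : (G.induce {u}ᶜ).Connected) : HasNFSD G 2 := by
  classical
  have h2 : (2 : ZMod 2) = 0 := rfl
  have hcu {x y : V} (h : G.Adj x y) : c x + c y = 1 := by
    have := hc x y h
    generalize c x = a at *
    generalize c y = b at *
    revert a b; decide
  have hodd (x : V) : (1 + G.degree x : ZMod 2) = 0 := by
    rcases hdeg x with h | h <;> rw [h] <;> rfl
  have hn : (Fintype.card V : ZMod 2) = 0 := by
    have h := congrArg (Nat.cast : ℕ → ZMod 2) G.sum_degrees_eq_twice_card_edges
    have h' : ∑ x, (1 + G.degree x : ZMod 2) = 0 := sum_eq_zero fun x _ => hodd x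
    rw [sum_add_distrib] at h'
    push_cast at h
    rw [h, h2] at h'
    simpa using h'
  let H : SimpleGraph V := G.deleteIncidenceSet u
  have hH {x y : V} : H.Adj x y ↔ G.Adj x y ∧ x ≠ u ∧ y ≠ u := G.deleteIncidenceSet_adj
  have hreach {x y : V} (hx : x ≠ u) (hy : y ≠ u) : H.Reachable x y := by
    let φ : G.induce {u}ᶜ →g H := ⟨Subtype.val, fun {a b} h => hH.2 ⟨h, a.2, b.2⟩⟩
    exact (hu.preconnected ⟨x, hx⟩ ⟨y, hy⟩).map φ
  obtain ⟨⟨r, hr⟩⟩ := hu.nonempty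
  let fV : V → ℕ := fun x => if x = u ∨ G.Adj u x then 2 else 1
  let p : V → ZMod 2 := fun x => if x = u then 0 else c x + c u + 1
  have hfVu : fV u = 2 := by simp [fV]
  have hfVa {y : V} (h : G.Adj u y) : fV y = 2 := by simp [fV, h]
  obtain ⟨fE, hE, hE2, hw⟩ := exists_edge_coloring_weight_parity G H
    (G.deleteIncidenceSet_le u) r fV p (fun x hx => by
      refine hreach hr ?_
      rintro rfl
      refine hx ?_
      have : ∑ y ∈ G.neighborFinset x, (fV y : ZMod 2) = 0 :=
        sum_eq_zero fun y hy => by rw [hfVa (by simpa using hy)]; rfl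
      rw [this, hfVu]
      simp [p, h2]) (by
      have h1 : ∑ x, (fV x : ZMod 2) * (1 + G.degree x) = 0 :=
        sum_eq_zero fun x _ => by rw [hodd, mul_zero]
      have h3 : ∑ x, p x = ∑ x, (c x + c u + 1) - 1 := by
        have : ∀ x, p x = (c x + c u + 1) - if x = u then 1 else 0 := fun x => by
          by_cases h : x = u
          · subst h
            simp only [p, if_true]
            linear_combination -c x * h2
          · simp [p, h]
        simp [this]
      rw [h1, h3]
      simp [sum_add_distrib, hc1, hn])
  have hEu (y : V) : fE s(u, y) = 2 := hE2 _ fun h => (hH.1 h).2.1 rfl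
  have hwu : nfsdWeight G fV fE u = 2 + 4 * G.degree u := by
    have : ∀ y ∈ G.neighborFinset u, fE s(u, y) + fV y = 4 := fun y hy => by
      rw [hEu, hfVa (by simpa using hy)]
    rw [nfsdWeight_eq_sum_neighborFinset, hfVu, sum_congr rfl this, sum_const, smul_eq_mul,
      mul_comm, G.card_neighborFinset_eq_degree]
  have hune {y : V} (h : G.Adj u y) : nfsdWeight G fV fE u ≠ nfsdWeight G fV fE y := by
    have hwy : nfsdWeight G fV fE y =
        6 + ∑ z ∈ (G.neighborFinset y).erase u, (fE s(y, z) + 1) := by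
      have hmem : u ∈ G.neighborFinset y := by simpa using h.symm
      have hz : ∀ z ∈ (G.neighborFinset y).erase u, fE s(y, z) + fV z = fE s(y, z) + 1 := by
        intro z hz
        obtain ⟨hzu, hyz⟩ := by simpa using hz
        have : ¬ G.Adj u z := fun h' => by
          have e1 := hcu h
          have e2 := hcu hyz
          have e3 := hcu h'
          generalize c u = a at *
          generalize c y = b at *
          generalize c z = d at *
          revert a b d; decide
        simp [fV, hzu, this]
      rw [← sum_congr rfl hz, nfsdWeight_eq_sum_neighborFinset, hfVa h,
        ← add_sum_erase _ _ hmem, Sym2.eq_swap, hEu, hfVu, ← add_assoc]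
    have hcardE : ((G.neighborFinset y).erase u).card + 1 = G.degree y := by
      rw [card_erase_add_one (by simpa using h.symm), G.card_neighborFinset_eq_degree]
    rw [hwu, hwy]
    rcases hdeg u with hd | hd
    · obtain ⟨w, hw⟩ : ∃ w, w ∉ ({u, y} : Finset V) := by
        by_contra! hall
        have : Fintype.card V ≤ ({u, y} : Finset V).card :=
          card_le_card fun x _ => hall x
        have := card_le_two (a := u) (b := y)
        omega
      obtain ⟨hwu, hwy⟩ : w ≠ u ∧ w ≠ y := by simpa using hw
      obtain ⟨z, hz⟩ : ∃ z, H.Adj y z := by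
        obtain ⟨q⟩ := hreach h.ne' hwu
        cases q with
        | nil => exact absurd rfl hwy
        | cons h _ => exact ⟨_, h⟩
      have := single_le_sum (f := fun z => fE s(y, z) + 1) (fun _ _ => Nat.zero_le _)
        (show z ∈ (G.neighborFinset y).erase u by
          simp [(hH.1 hz).1, (hH.1 hz).2.2])
      omega
    · have := sum_le_card_nsmul ((G.neighborFinset y).erase u) (fun z => fE s(y, z) + 1) 3
        fun z _ => by have := (mem_Icc.1 (hE s(y, z))).2; omega
      rw [smul_eq_mul] at this
      rcases hdeg y with h' | h' <;> omega
  refine ⟨fV, fE, fun v => by simp only [fV]; split_ifs <;> simp, fun e _ => hE e,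
    fun x y hxy => ?_⟩
  by_cases hx : x = u
  · subst hx; exact hune hxy
  by_cases hy : y = u
  · subst hy; exact (hune hxy.symm).symm
  intro heq
  have := congrArg (Nat.cast : ℕ → ZMod 2) heq
  rw [hw, hw] at this
  simp only [p, hx, hy, if_false, add_left_inj] at this
  exact hc x y hxy this

theorem hasNFSD_two_of_parity {V : Type*} [Fintype V] (G : SimpleGraph V) [DecidableRel G.Adj]
    (hconn : G.Connected) (c : V → ZMod 2) (hc : ∀ x y, G.Adj x y → c x ≠ c y) (fV : V → ℕ)
    (hfV : ∀ v, fV v ∈ Icc 1 2)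
    (hsum : ∑ x, c x = ∑ x, (fV x : ZMod 2) * (1 + G.degree x)) : HasNFSD G 2 := by
  classical
  obtain ⟨r⟩ := hconn.nonempty
  obtain ⟨fE, hE, -, hw⟩ := exists_edge_coloring_weight_parity G G le_rfl r fV c
    (fun x _ => hconn.preconnected r x) hsum
  refine ⟨fV, fE, hfV, fun e _ => hE e, fun x y hxy heq => hc x y hxy ?_⟩
  rw [← hw, ← hw, heq]

theorem stmt_19 {V : Type*} [Fintype V] (G : SimpleGraph V) [DecidableRel G.Adj]
    (hconn : G.Connected) (hcard : 3 ≤ Fintype.card V)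
    (hbip : G.Colorable 2) (hmax : G.maxDegree = 3) :
    fgndi G ≤ 2 ∧ HasNFSD G 2 := by
  classical
  suffices h : HasNFSD G 2 from ⟨Nat.sInf_le h, h⟩
  have h2 : (2 : ZMod 2) = 0 := rfl
  obtain ⟨C⟩ := hbip
  let c : V → ZMod 2 := C
  have hc : ∀ x y, G.Adj x y → c x ≠ c y := fun x y h => C.valid h
  have h01 (a : ZMod 2) : a = 0 ∨ a = 1 := by revert a; decide
  rcases h01 (∑ x, c x) with h0 | h1
  · exact hasNFSD_two_of_parity G hconn c hc (fun _ => 2) (by simp) (by simp [h0, h2])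
  by_cases hev : ∃ z, Even (G.degree z)
  · obtain ⟨z, hz⟩ := hev
    refine hasNFSD_two_of_parity G hconn c hc (fun x => if x = z then 1 else 2)
      (fun v => by split_ifs <;> simp) ?_
    have : ∀ x, ((if x = z then 1 else 2 : ℕ) : ZMod 2) = if x = z then 1 else 0 := fun x => by
      split_ifs <;> simp [h2]
    simp [this, h1, (ZMod.natCast_eq_zero_iff_even).2 hz]
  · push Not at hev
    have : Nontrivial V := Fintype.one_lt_card_iff_nontrivial.1 (by omega)
    obtain ⟨u, hu⟩ := hconn.exists_connected_induce_compl_singleton_of_finite_nontrivial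
    refine hasNFSD_two_of_odd_degrees G hcard c hc h1 (fun x => ?_) u hu
    have := G.degree_le_maxDegree x
    have := Nat.not_even_iff.1 (hev x)
    omega
end
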